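/- Let [a,b] ⊂ ℝ be compact, f₀ a probability density on [a,b] with f₀ > 0 and I₀ = TV(log f₀) < ∞, and let x₁,...,xₙ be i.i.d. with density f₀. Let F be the class of probability densities f on [a,b] with f > 0 and TV(log f) < ∞, and set J(f) = 1 + TV(log f) + I₀, p_f = (1/2) log((f + f₀)/(2f₀)), P_n(g) = (1/n)Σᵢ g(xᵢ), P(g) = ∫ g f₀ dx. Define the data-dependent penalty λₙ = max{ sup over {f ∈ F : h(f, f₀) ≤ n^{−1/3} J(f)} of 4|(P_n − P)(p_f)|/J(f), n^{−2/3} }. Then: (i) λₙ = O_P(n^{−2/3}), i.e., for every ε > 0 there are K and n₁ with P(λₙ·n^{2/3} > K) < ε for all n ≥ n₁; and (ii) there exist constants C and n₀ such that for all n ≥ n₀, every f̂ₙ ∈ F minimizing −P_n(log f) + λₙ·TV(log f) over F satisfies E[h²(f̂ₙ, f₀)] ≤ C·n^{−2/3}. -/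

import Mathlib

open MeasureTheory Set

/-- membership in the class `F` of probability densities on `[a,b]` that are
positive with log of bounded variation. -/
def InF (a b : ℝ) (f : ℝ → ℝ) : Prop :=
  (∀ t ∈ Set.Icc a b, 0 < f t) ∧
    MeasureTheory.IntegrableOn f (Set.Icc a b) ∧
    (∫ t in Set.Icc a b, f t) = 1 ∧
    eVariationOn (fun t => Real.log (f t)) (Set.Icc a b) ≠ ⊤

/-- `I(f) = TV(log f)` on `[a,b]`. -/
noncomputable def Ifun (a b : ℝ) (f : ℝ → ℝ) : ℝ :=
  (eVariationOn (fun t => Real.log (f t)) (Set.Icc a b)).toReal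

/-- `J(f) = 1 + I(f) + I₀`. -/
noncomputable def Jfun (a b : ℝ) (f₀ f : ℝ → ℝ) : ℝ :=
  1 + Ifun a b f + Ifun a b f₀

/-- squared Hellinger distance. -/
noncomputable def hellSq (a b : ℝ) (f g : ℝ → ℝ) : ℝ :=
  (1 / 2) * ∫ t in Set.Icc a b, (Real.sqrt (f t) - Real.sqrt (g t)) ^ 2

/-- Hellinger distance. -/
noncomputable def hell (a b : ℝ) (f g : ℝ → ℝ) : ℝ :=
  Real.sqrt (hellSq a b f g)

/-- `p_f = (1/2) log((f + f₀)/(2 f₀))`. -/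
noncomputable def pfun (f₀ f : ℝ → ℝ) : ℝ → ℝ :=
  fun t => (1 / 2) * Real.log ((f t + f₀ t) / (2 * f₀ t))

/-- the centered empirical process `(Pₙ - P)(g)` from the first `n` points of
the sample `X`, where `P(g) = ∫ₐᵇ g f₀`. -/
noncomputable def empProc {Ω : Type*} (a b : ℝ) (f₀ : ℝ → ℝ) (n : ℕ)
    (X : ℕ → Ω → ℝ) (g : ℝ → ℝ) (ω : Ω) : ℝ :=
  (1 / (n : ℝ)) * ∑ i ∈ Finset.range n, g (X i ω)
    - ∫ t in Set.Icc a b, g t * f₀ t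

/-- the data-dependent penalty
`λₙ = max{ sup_{h(f,f₀) ≤ n^{-1/3}J(f)} 4|(Pₙ-P)(p_f)|/J(f), n^{-2/3} }`. -/
noncomputable def lamFDE {Ω : Type*} (a b : ℝ) (f₀ : ℝ → ℝ) (n : ℕ)
    (X : ℕ → Ω → ℝ) (ω : Ω) : ℝ :=
  max (sSup {r : ℝ | ∃ f : ℝ → ℝ, InF a b f ∧
      hell a b f f₀ ≤ (n : ℝ) ^ (-(1 : ℝ)/3) * Jfun a b f₀ f ∧
      r = 4 * |empProc a b f₀ n X (pfun f₀ f) ω| / Jfun a b f₀ f})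
    ((n : ℝ) ^ (-(2 : ℝ)/3))

theorem sum_range_two_mul (f : ℕ → ℝ) (n : ℕ) :
    ∑ i ∈ Finset.range (2 * n), f i = ∑ j ∈ Finset.range n, (f (2 * j) + f (2 * j + 1)) := by
  induction n with
  | zero => simp
  | succ n ih =>
    rw [show 2 * (n + 1) = 2 * n + 1 + 1 by ring, Finset.sum_range_succ, Finset.sum_range_succ, ih,
      Finset.sum_range_succ]
    ring

theorem le_add_pow_three_div {z t : ℝ} (hz : 0 ≤ z) (ht : 0 < t) : z ≤ t + z ^ 3 / t ^ 2 := by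
  rcases le_total z t with h | h
  · have : 0 ≤ z ^ 3 / t ^ 2 := by positivity
    linarith
  · have : z ≤ z ^ 3 / t ^ 2 := by
      rw [le_div_iff₀ (by positivity)]
      have : t ^ 2 ≤ z ^ 2 := by gcongr
      nlinarith
    linarith

/-- A truncated duality bound: `|z| ≤ t` is paired with the `ℓ¹` norm of `d`, the excess with its
`ℓ²` norm. -/
theorem sum_abs_mul_abs_le (s : Finset ℕ) (d z : ℕ → ℝ) {t : ℝ} (ht : 0 < t) :
    ∑ i ∈ s, |d i| * |z i| ≤
      t * ∑ i ∈ s, |d i| + √(∑ i ∈ s, d i ^ 2) * √(∑ i ∈ s, z i ^ 6) / t ^ 2 := by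
  have h1 : ∑ i ∈ s, |d i| * |z i| ≤ ∑ i ∈ s, (t * |d i| + |d i| * |z i| ^ 3 / t ^ 2) := by
    refine Finset.sum_le_sum fun i _ => ?_
    have := mul_le_mul_of_nonneg_left (le_add_pow_three_div (abs_nonneg (z i)) ht)
      (abs_nonneg (d i))
    calc _ ≤ _ := this
      _ = _ := by ring
  have h2 := Real.sum_mul_le_sqrt_mul_sqrt s (fun i => |d i|) (fun i => |z i| ^ 3)
  have h3 : ∀ i, (|z i| ^ 3) ^ 2 = z i ^ 6 := fun i => by
    rw [← pow_mul, show 3 * 2 = 2 * 3 by norm_num, pow_mul, sq_abs]; ring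
  simp only [sq_abs, h3] at h2
  rw [Finset.sum_add_distrib, ← Finset.mul_sum, ← Finset.sum_div] at h1
  refine h1.trans ?_
  gcongr

theorem abs_dyadic_increment_le {c Z : ℕ → ℕ → ℝ} {v : ℕ → ℝ} {V s t : ℝ} {k : ℕ} (ht : 0 < t)
    (hs : 0 ≤ s)
    (hZ : ∀ j < 2 ^ k, Z k j = Z (k + 1) (2 * j) + Z (k + 1) (2 * j + 1))
    (hv : ∑ j ∈ Finset.range (2 ^ k), v j ≤ V)
    (hc₀ : ∀ j < 2 ^ k, |c (k + 1) (2 * j) - c k j| ≤ v j)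
    (hc₁ : ∀ j < 2 ^ k, |c (k + 1) (2 * j + 1) - c k j| ≤ v j)
    (hsq : ∀ m, ∑ j ∈ Finset.range (2 ^ m), c m j ^ 2 ≤ 2 ^ m * s ^ 2) :
    |∑ j ∈ Finset.range (2 ^ (k + 1)), c (k + 1) j * Z (k + 1) j
        - ∑ j ∈ Finset.range (2 ^ k), c k j * Z k j| ≤
      2 * t * V + 3 * √(2 ^ k) * s *
        √(∑ j ∈ Finset.range (2 ^ (k + 1)), Z (k + 1) j ^ 6) / t ^ 2 := by
  set d : ℕ → ℝ := fun i => c (k + 1) i - c k (i / 2) with hd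
  have e0 : ∀ j, (2 * j) / 2 = j := fun j => by omega
  have e1 : ∀ j, (2 * j + 1) / 2 = j := fun j => by omega
  have key : ∑ j ∈ Finset.range (2 ^ (k + 1)), c (k + 1) j * Z (k + 1) j
        - ∑ j ∈ Finset.range (2 ^ k), c k j * Z k j
      = ∑ i ∈ Finset.range (2 ^ (k + 1)), d i * Z (k + 1) i := by
    rw [pow_succ', sum_range_two_mul, sum_range_two_mul, ← Finset.sum_sub_distrib]
    refine Finset.sum_congr rfl fun j hj => ?_
    simp only [hd, e0, e1, hZ j (Finset.mem_range.1 hj)]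
    ring
  have l1 : ∑ i ∈ Finset.range (2 ^ (k + 1)), |d i| ≤ 2 * V := by
    rw [pow_succ', sum_range_two_mul]
    calc _ ≤ ∑ j ∈ Finset.range (2 ^ k), 2 * v j := by
          refine Finset.sum_le_sum fun j hj => ?_
          have hj := Finset.mem_range.1 hj
          simp only [hd, e0, e1]
          linarith [hc₀ j hj, hc₁ j hj]
      _ ≤ _ := by rw [← Finset.mul_sum]; linarith
  have l2 : ∑ i ∈ Finset.range (2 ^ (k + 1)), d i ^ 2 ≤ (3 * √(2 ^ k) * s) ^ 2 := by
    have h4 : ∑ i ∈ Finset.range (2 ^ (k + 1)), c k (i / 2) ^ 2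
        = 2 * ∑ j ∈ Finset.range (2 ^ k), c k j ^ 2 := by
      rw [pow_succ', sum_range_two_mul, Finset.mul_sum]
      refine Finset.sum_congr rfl fun j _ => ?_
      rw [e0, e1]; ring
    calc _ ≤ ∑ i ∈ Finset.range (2 ^ (k + 1)), (2 * c (k + 1) i ^ 2 + 2 * c k (i / 2) ^ 2) := by
          refine Finset.sum_le_sum fun i _ => ?_
          simp only [hd]
          nlinarith [sq_nonneg (c (k + 1) i + c k (i / 2))]
      _ = 2 * ∑ i ∈ Finset.range (2 ^ (k + 1)), c (k + 1) i ^ 2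
          + 2 * (2 * ∑ j ∈ Finset.range (2 ^ k), c k j ^ 2) := by
          rw [Finset.sum_add_distrib, ← Finset.mul_sum, ← Finset.mul_sum, h4]
      _ ≤ 2 * (2 ^ (k + 1) * s ^ 2) + 2 * (2 * (2 ^ k * s ^ 2)) := by
          gcongr <;> exact hsq _
      _ = 8 * 2 ^ k * s ^ 2 := by ring
      _ ≤ 9 * 2 ^ k * s ^ 2 := by gcongr; norm_num
      _ = _ := by
          rw [mul_pow, mul_pow, Real.sq_sqrt (by positivity)]; norm_num
  rw [key]
  calc _ ≤ ∑ i ∈ Finset.range (2 ^ (k + 1)), |d i| * |Z (k + 1) i| := by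
        simpa only [abs_mul] using Finset.abs_sum_le_sum_abs (fun i => d i * Z (k + 1) i) _
    _ ≤ _ := sum_abs_mul_abs_le _ d (Z (k + 1)) ht
    _ ≤ t * (2 * V) + (3 * √(2 ^ k) * s) *
        √(∑ j ∈ Finset.range (2 ^ (k + 1)), Z (k + 1) j ^ 6) / t ^ 2 := by
        gcongr
        exact (Real.sqrt_le_left (by positivity)).2 l2
    _ = _ := by ring

/-- The dominating statistic for the dyadic chaining argument. -/
noncomputable def chainStat (Z : ℕ → ℕ → ℝ) (K : ℕ) : ℝ :=
  (2 ^ K) ^ 3 * ∑ j ∈ Finset.range (2 ^ K), Z K j ^ 2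
    + ∑ l ∈ Finset.range K, (2 * (10 / 9) ^ 5) ^ l * ((2 ^ K) ^ 11 *
        ∑ j ∈ Finset.range (2 ^ (K + l + 1)), Z (K + l + 1) j ^ 6)
    + (2 ^ K) ^ 12 * ∑ j ∈ Finset.range (2 ^ (2 * K)), Z (2 * K) j ^ 6

theorem sum_pow_mul_pow_six_nonneg (Z : ℕ → ℝ) (m : ℕ) : 0 ≤ ∑ j ∈ Finset.range m, Z j ^ 6 :=
  Finset.sum_nonneg fun _ _ => by positivity

theorem chainStat_nonneg (Z : ℕ → ℕ → ℝ) (K : ℕ) : 0 ≤ chainStat Z K := by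
  have := sum_pow_mul_pow_six_nonneg
  unfold chainStat
  refine add_nonneg (add_nonneg ?_ (Finset.sum_nonneg fun l _ => ?_)) ?_
  · exact mul_nonneg (by positivity) (Finset.sum_nonneg fun _ _ => by positivity)
  · exact mul_nonneg (by positivity) (mul_nonneg (by positivity) (this _ _))
  · exact mul_nonneg (by positivity) (this _ _)

theorem geom_sum_nine_tenths_le (K : ℕ) : ∑ l ∈ Finset.range K, (9 / 10 : ℝ) ^ l ≤ 10 := by
  rw [geom_sum_eq (by norm_num)]
  have : (0 : ℝ) ≤ (9 / 10) ^ K := by positivity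
  rw [div_le_iff_of_neg (by norm_num)]
  linarith

theorem abs_dyadic_sum_le {c Z v : ℕ → ℕ → ℝ} {V s : ℝ} (hs : 0 ≤ s) (hV : 0 ≤ V)
    (hZ : ∀ k, ∀ j < 2 ^ k, Z k j = Z (k + 1) (2 * j) + Z (k + 1) (2 * j + 1))
    (hv : ∀ k, ∑ j ∈ Finset.range (2 ^ k), v k j ≤ V)
    (hc₀ : ∀ k, ∀ j < 2 ^ k, |c (k + 1) (2 * j) - c k j| ≤ v k j)
    (hc₁ : ∀ k, ∀ j < 2 ^ k, |c (k + 1) (2 * j + 1) - c k j| ≤ v k j)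
    (hsq : ∀ k, ∑ j ∈ Finset.range (2 ^ k), c k j ^ 2 ≤ 2 ^ k * s ^ 2) (K : ℕ) :
    |∑ j ∈ Finset.range (2 ^ (2 * K)), c (2 * K) j * Z (2 * K) j| ≤
      (s / 2 ^ K + V / (2 ^ K) ^ 2) * (20 + 13 * √(chainStat Z K)) := by
  set N : ℝ := 2 ^ K with hN
  have hNpos : 0 < N := by positivity
  set R := chainStat Z K with hR
  have hQ := sum_pow_mul_pow_six_nonneg
  set A : ℕ → ℝ := fun k => ∑ j ∈ Finset.range (2 ^ k), c k j * Z k j with hA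
  set Q : ℕ → ℝ := fun k => ∑ j ∈ Finset.range (2 ^ k), Z k j ^ 6 with hQd
  have hQn : ∀ k, 0 ≤ Q k := fun k => hQ _ _
  set B : ℕ → ℝ := fun l => (2 * (10 / 9) ^ 5) ^ l * (N ^ 11 * Q (K + l + 1)) with hB
  have hBn : ∀ l, 0 ≤ B l := fun l => mul_nonneg (by positivity) (mul_nonneg (by positivity) (hQn _))
  have hS2 : 0 ≤ ∑ j ∈ Finset.range (2 ^ K), Z K j ^ 2 := Finset.sum_nonneg fun _ _ => by positivity
  have hRe : R = N ^ 3 * ∑ j ∈ Finset.range (2 ^ K), Z K j ^ 2 + ∑ l ∈ Finset.range K, B l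
      + N ^ 12 * Q (2 * K) := rfl
  have hR2 : ∑ l ∈ Finset.range K, B l ≤ R := by
    rw [hRe]
    have := mul_nonneg (pow_nonneg hNpos.le 3) hS2
    have := mul_nonneg (pow_nonneg hNpos.le 12) (hQn (2 * K))
    linarith
  have hR1 : N ^ 3 * ∑ j ∈ Finset.range (2 ^ K), Z K j ^ 2 ≤ R := by
    rw [hRe]
    have := Finset.sum_nonneg fun l (_ : l ∈ Finset.range K) => hBn l
    have := mul_nonneg (pow_nonneg hNpos.le 12) (hQn (2 * K))
    linarith
  have hbase : |A K| ≤ s / N * √R := by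
    have h := Finset.sum_mul_sq_le_sq_mul_sq (Finset.range (2 ^ K)) (c K) (Z K)
    refine abs_le_of_sq_le_sq ?_ (by positivity)
    rw [mul_pow, Real.sq_sqrt (chainStat_nonneg Z K)]
    calc A K ^ 2 ≤ _ := h
      _ ≤ (N * s ^ 2) * ∑ j ∈ Finset.range (2 ^ K), Z K j ^ 2 := by
        gcongr; exact hsq K
      _ = (s / N) ^ 2 * (N ^ 3 * ∑ j ∈ Finset.range (2 ^ K), Z K j ^ 2) := by field_simp
      _ ≤ _ := by gcongr
  have hstep : ∀ l, |A (K + l + 1) - A (K + l)| ≤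
      2 * V / N ^ 2 * (9 / 10) ^ l + 3 * (s / N) * (√((9 / 10) ^ l) * √(B l)) := by
    intro l
    have h := abs_dyadic_increment_le (c := c) (Z := Z) (v := v (K + l)) (V := V) (s := s)
      (t := (9 / 10) ^ l / N ^ 2) (k := K + l) (by positivity) hs (hZ _) (hv _) (hc₀ _) (hc₁ _) hsq
    refine h.trans (le_of_eq ?_)
    have e : √(2 ^ (K + l)) * √(Q (K + l + 1)) * (N ^ 2) ^ 2 / ((9 / 10) ^ l) ^ 2
        = (√((9 / 10) ^ l) * √(B l)) / N := by
      have hq : (2 * (10 / 9 : ℝ) ^ 5) ^ l = 2 ^ l / ((9 / 10) ^ l) ^ 5 := by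
        rw [mul_pow, ← pow_mul, mul_comm 5 l, pow_mul,
          show (10 / 9 : ℝ) = (9 / 10)⁻¹ by norm_num, inv_pow, inv_pow, ← div_eq_mul_inv]
      have hq0 : (0 : ℝ) < (9 / 10) ^ l := by positivity
      have hp : (2 : ℝ) ^ (K + l) = N * 2 ^ l := pow_add _ _ _
      have : ((9 / 10) ^ l * B l) =
          (N ^ 5 / ((9 / 10) ^ l) ^ 2) ^ 2 * (2 ^ (K + l) * Q (K + l + 1)) := by
        simp only [hB]
        rw [hq, hp]
        generalize ((9 / 10 : ℝ)) ^ l = q at *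
        field_simp
      rw [← Real.sqrt_mul hq0.le, this, Real.sqrt_mul (sq_nonneg _), Real.sqrt_sq (by positivity),
        Real.sqrt_mul (by positivity)]
      field_simp
    have e' : 3 * (s / N) * (√((9 / 10) ^ l) * √(B l)) =
        3 * s * ((√((9 / 10) ^ l) * √(B l)) / N) := by ring
    rw [e', ← e]
    simp only [hQd]
    field_simp
  have htel : A (2 * K) = A K + ∑ l ∈ Finset.range K, (A (K + l + 1) - A (K + l)) := by
    have := Finset.sum_range_sub (fun l => A (K + l)) K
    simp only [← add_assoc] at this
    rw [this]; simp [two_mul]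
  have hcs : ∑ l ∈ Finset.range K, √((9 / 10) ^ l) * √(B l) ≤ 4 * √R := by
    refine (Real.sum_sqrt_mul_sqrt_le _ (fun l => by positivity) hBn).trans ?_
    gcongr
    rw [Real.sqrt_le_left (by norm_num)]
    exact (geom_sum_nine_tenths_le K).trans (by norm_num)
  have h1 : |A (2 * K)| ≤ s / N * √R + (2 * V / N ^ 2 * 10 + 3 * (s / N) * (4 * √R)) := by
    rw [htel]
    refine (abs_add_le _ _).trans (add_le_add hbase ?_)
    refine (Finset.abs_sum_le_sum_abs _ _).trans ((Finset.sum_le_sum fun l _ => hstep l).trans ?_)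
    rw [Finset.sum_add_distrib, ← Finset.mul_sum, ← Finset.mul_sum]
    gcongr
    exact geom_sum_nine_tenths_le K
  have h2 : 0 ≤ V / N ^ 2 * √R := by positivity
  have h3 : 0 ≤ s / N := by positivity
  calc _ ≤ _ := h1
    _ = 13 * (s / N * √R) + 20 * (V / N ^ 2) := by ring
    _ ≤ _ := by nlinarith

/-- The `j`-th point of the dyadic grid of level `k` on `[a, b]`. -/
noncomputable def gridPt (a b : ℝ) (k j : ℕ) : ℝ := a + (b - a) * j / 2 ^ k

/-- Empirical minus theoretical mass of the `j`-th dyadic cell of level `k`. -/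
noncomputable def cellDev (a b : ℝ) (f₀ : ℝ → ℝ) (n : ℕ) (x : ℕ → ℝ) (k j : ℕ) : ℝ :=
  (1 / (n : ℝ)) * ∑ i ∈ Finset.range n,
      (Set.Ioc (gridPt a b k j) (gridPt a b k (j + 1))).indicator 1 (x i)
    - ∫ t in gridPt a b k j..gridPt a b k (j + 1), f₀ t

theorem gridPt_zero (a b : ℝ) (k : ℕ) : gridPt a b k 0 = a := by simp [gridPt]

theorem gridPt_last (a b : ℝ) (k : ℕ) : gridPt a b k (2 ^ k) = b := by simp [gridPt]

theorem gridPt_succ_two_mul (a b : ℝ) (k j : ℕ) : gridPt a b (k + 1) (2 * j) = gridPt a b k j := by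
  simp only [gridPt, pow_succ]
  push_cast
  field_simp

theorem gridPt_succ_sub (a b : ℝ) (k j : ℕ) :
    gridPt a b k (j + 1) - gridPt a b k j = (b - a) / 2 ^ k := by
  simp only [gridPt]
  push_cast
  ring

theorem gridPt_mono {a b : ℝ} (hab : a < b) (k : ℕ) : Monotone (gridPt a b k) := by
  refine monotone_nat_of_le_succ fun j => ?_
  have : 0 ≤ (b - a) / 2 ^ k := div_nonneg (by linarith) (by positivity)
  linarith [gridPt_succ_sub a b k j]

theorem gridPt_mem {a b : ℝ} (hab : a < b) {k j : ℕ} (hj : j ≤ 2 ^ k) :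
    gridPt a b k j ∈ Set.Icc a b := by
  constructor
  · simpa only [gridPt_zero] using gridPt_mono hab k (Nat.zero_le j)
  · simpa only [gridPt_last] using gridPt_mono hab k hj

theorem indicator_Ioc_one_eq {u w : ℝ} (h : u ≤ w) (x : ℝ) :
    (Set.Ioc u w).indicator (1 : ℝ → ℝ) x
      = (Set.Iic w).indicator 1 x - (Set.Iic u).indicator 1 x := by
  simp only [Set.indicator_apply, Set.mem_Ioc, Set.mem_Iic, Pi.one_apply]
  by_cases h1 : x ≤ u
  · simp [h1, h1.trans h]
  · simp [h1, lt_of_not_ge h1]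

theorem sum_indicator_grid {a b x : ℝ} (hab : a < b) (hx : x ∈ Set.Ioc a b) (k : ℕ) :
    ∑ j ∈ Finset.range (2 ^ k),
      (Set.Ioc (gridPt a b k j) (gridPt a b k (j + 1))).indicator (1 : ℝ → ℝ) x = 1 := by
  simp only [indicator_Ioc_one_eq (gridPt_mono hab k (Nat.le_succ _))]
  rw [Finset.sum_range_sub (fun j => (Set.Iic (gridPt a b k j)).indicator (1 : ℝ → ℝ) x),
    gridPt_last, gridPt_zero]
  simp [hx.2, hx.1]

/-- The mean of `g` over `[u, w]` is within `v` of `z` whenever `g` is on `(u, w]`. -/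
theorem abs_mean_sub_le {g : ℝ → ℝ} {u w z v : ℝ} (huw : u < w)
    (hg : IntervalIntegrable g volume u w) (h : ∀ x ∈ Set.Ioc u w, |g x - z| ≤ v) :
    |(∫ x in u..w, g x) / (w - u) - z| ≤ v := by
  have hpos : 0 < w - u := sub_pos.2 huw
  have h1 := intervalIntegral.norm_integral_le_of_norm_le_const (a := u) (b := w) (C := v)
    (f := fun x => g x - z) (by rw [Set.uIoc_of_le huw.le]; exact h)
  rw [intervalIntegral.integral_sub hg (by simp), intervalIntegral.integral_const,
    Real.norm_eq_abs, abs_of_pos hpos, smul_eq_mul] at h1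
  have h2 : (∫ x in u..w, g x) / (w - u) - z = ((∫ x in u..w, g x) - (w - u) * z) / (w - u) := by
    field_simp
  rw [h2, abs_div, abs_of_pos hpos, div_le_iff₀ hpos]
  exact h1

theorem mean_sq_mul_le {g : ℝ → ℝ} {u w : ℝ} (huw : u < w)
    (hg : IntervalIntegrable g volume u w)
    (hg2 : IntervalIntegrable (fun x => g x ^ 2) volume u w) :
    ((∫ x in u..w, g x) / (w - u)) ^ 2 * (w - u) ≤ ∫ x in u..w, g x ^ 2 := by
  have hpos : 0 < w - u := sub_pos.2 huw
  set c := (∫ x in u..w, g x) / (w - u) with hc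
  have hci : ∫ x in u..w, g x = c * (w - u) := by rw [hc]; field_simp
  have h0 : 0 ≤ ∫ x in u..w, (g x - c) ^ 2 :=
    intervalIntegral.integral_nonneg huw.le fun x _ => sq_nonneg _
  have h1 : ∫ x in u..w, (g x - c) ^ 2
      = (∫ x in u..w, g x ^ 2) - 2 * c * (∫ x in u..w, g x) + c ^ 2 * (w - u) := by
    rw [← intervalIntegral.integral_const_mul, ← intervalIntegral.integral_sub hg2 (hg.const_mul _),
      show c ^ 2 * (w - u) = ∫ x in u..w, c ^ 2 by simp [mul_comm],
      ← intervalIntegral.integral_add (hg2.sub (hg.const_mul _)) (by simp)]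
    refine intervalIntegral.integral_congr fun x _ => ?_
    ring
  rw [h1, hci] at h0
  nlinarith

theorem intervalIntegrable_of_mem_Icc {a b u w : ℝ} {g : ℝ → ℝ} (hab : a < b)
    (hg : IntervalIntegrable g volume a b) (hu : u ∈ Set.Icc a b) (hw : w ∈ Set.Icc a b) :
    IntervalIntegrable g volume u w :=
  hg.mono_set (by rw [Set.uIcc_of_le hab.le]; exact Set.uIcc_subset_Icc hu hw)

theorem cellDev_eq_add {a b : ℝ} (hab : a < b) {f₀ : ℝ → ℝ}
    (hf₀ : IntervalIntegrable f₀ volume a b) (n : ℕ) (x : ℕ → ℝ) {k j : ℕ} (hj : j < 2 ^ k) :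
    cellDev a b f₀ n x k j =
      cellDev a b f₀ n x (k + 1) (2 * j) + cellDev a b f₀ n x (k + 1) (2 * j + 1) := by
  have e1 : gridPt a b (k + 1) (2 * j + 1 + 1) = gridPt a b k (j + 1) := by
    rw [show 2 * j + 1 + 1 = 2 * (j + 1) by ring, gridPt_succ_two_mul]
  have h := gridPt_mono hab (k + 1) (Nat.le_add_right (2 * j) 1)
  have h' := gridPt_mono hab (k + 1) (Nat.le_add_right (2 * j + 1) 1)
  rw [e1] at h'
  rw [gridPt_succ_two_mul] at h
  simp only [cellDev, e1, gridPt_succ_two_mul]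
  have hm := gridPt_mem hab (k := k + 1) (j := 2 * j + 1) (by rw [pow_succ]; omega)
  rw [← intervalIntegral.integral_add_adjacent_intervals (b := gridPt a b (k + 1) (2 * j + 1))
    (intervalIntegrable_of_mem_Icc hab hf₀ (gridPt_mem hab hj.le) hm)
    (intervalIntegrable_of_mem_Icc hab hf₀ hm (gridPt_mem hab hj))]
  simp only [indicator_Ioc_one_eq h, indicator_Ioc_one_eq h', indicator_Ioc_one_eq (h.trans h'),
    Finset.sum_sub_distrib]
  ring

theorem integral_cell_nonneg {a b : ℝ} (hab : a < b) {f₀ : ℝ → ℝ}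
    (h0 : ∀ t ∈ Set.Icc a b, 0 ≤ f₀ t) {k j : ℕ} (hj : j < 2 ^ k) :
    0 ≤ ∫ t in gridPt a b k j..gridPt a b k (j + 1), f₀ t :=
  intervalIntegral.integral_nonneg (gridPt_mono hab k (Nat.le_succ j)) fun t ht =>
    h0 t ⟨(gridPt_mem hab hj.le).1.trans ht.1, ht.2.trans (gridPt_mem hab hj).2⟩

theorem integral_cell_le {a b M : ℝ} (hab : a < b) {f₀ : ℝ → ℝ}
    (hf₀ : IntervalIntegrable f₀ volume a b)
    (hM : ∀ t ∈ Set.Icc a b, f₀ t ≤ M) {k j : ℕ} (hj : j < 2 ^ k) :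
    ∫ t in gridPt a b k j..gridPt a b k (j + 1), f₀ t ≤ M * (b - a) / 2 ^ k := by
  have hi := intervalIntegrable_of_mem_Icc hab hf₀ (gridPt_mem hab hj.le) (gridPt_mem hab hj)
  have := intervalIntegral.integral_mono_on (gridPt_mono hab k (Nat.le_succ j)) hi
    (intervalIntegrable_const (c := M)) fun t ht =>
      hM t ⟨(gridPt_mem hab hj.le).1.trans ht.1, ht.2.trans (gridPt_mem hab hj).2⟩
  rw [intervalIntegral.integral_const, Nat.succ_eq_add_one, gridPt_succ_sub, smul_eq_mul] at this
  calc _ ≤ _ := this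
    _ = _ := by ring

/-- Deterministic chaining bound: the empirical process at `g` is controlled by the `L²` size and
the variation of `g`, uniformly in `g`. -/
theorem abs_empirical_le {a b M V s : ℝ} (hab : a < b) {f₀ g W : ℝ → ℝ} {n : ℕ} (x : ℕ → ℝ)
    (hx : ∀ i < n, x i ∈ Set.Ioc a b)
    (hf₀ : IntervalIntegrable f₀ volume a b)
    (h0 : ∀ t ∈ Set.Icc a b, 0 ≤ f₀ t) (hM : ∀ t ∈ Set.Icc a b, f₀ t ≤ M)
    (hg : IntervalIntegrable g volume a b)
    (hg2 : IntervalIntegrable (fun t => g t ^ 2) volume a b)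
    (hgf : IntervalIntegrable (fun t => g t * f₀ t) volume a b)
    (hW : ∀ u ∈ Set.Icc a b, ∀ w ∈ Set.Icc a b, u ≤ w → |g u - g w| ≤ W w - W u)
    (hWV : W b - W a ≤ V) (hs : 0 ≤ s) (hs2 : ∫ t in a..b, g t ^ 2 ≤ (b - a) * s ^ 2) (K : ℕ) :
    |(1 / (n : ℝ)) * ∑ i ∈ Finset.range n, g (x i) - ∫ t in a..b, g t * f₀ t| ≤
      (s / 2 ^ K + V / (2 ^ K) ^ 2) *
        (21 + 2 * (M * (b - a)) + 14 * √(chainStat (cellDev a b f₀ n x) K)) := by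
  set N : ℝ := 2 ^ K with hN
  have hNpos : 0 < N := by positivity
  have hba : 0 < b - a := sub_pos.2 hab
  set Z := cellDev a b f₀ n x with hZd
  set T := gridPt a b with hT
  have hTlt : ∀ k j, T k j < T k (j + 1) := fun k j => by
    have := gridPt_succ_sub a b k j
    have : 0 < (b - a) / 2 ^ k := by positivity
    simp only [hT]; linarith
  set c : ℕ → ℕ → ℝ := fun k j => (∫ t in T k j..T k (j + 1), g t) / (T k (j + 1) - T k j) with hc
  set v : ℕ → ℕ → ℝ := fun k j => W (T k (j + 1)) - W (T k j) with hv
  have hmem : ∀ {k j : ℕ}, j < 2 ^ k → ∀ t ∈ Set.Icc (T k j) (T k (j + 1)), t ∈ Set.Icc a b :=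
    fun hj t ht => ⟨(gridPt_mem hab hj.le).1.trans ht.1, ht.2.trans (gridPt_mem hab hj).2⟩
  have hint : ∀ {h : ℝ → ℝ}, IntervalIntegrable h volume a b → ∀ {k j : ℕ}, j < 2 ^ k →
      IntervalIntegrable h volume (T k j) (T k (j + 1)) := fun hh _ _ hj =>
    intervalIntegrable_of_mem_Icc hab hh (gridPt_mem hab hj.le) (gridPt_mem hab hj)
  have hsum : ∀ {h : ℝ → ℝ}, IntervalIntegrable h volume a b → ∀ k,
      ∑ j ∈ Finset.range (2 ^ k), ∫ t in T k j..T k (j + 1), h t = ∫ t in a..b, h t := by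
    intro h hh k
    rw [intervalIntegral.sum_integral_adjacent_intervals (a := T k) fun j hj => hint hh hj, hT, gridPt_zero,
      gridPt_last]
  have hosc : ∀ {k j : ℕ}, j < 2 ^ k → ∀ y ∈ Set.Icc (T k j) (T k (j + 1)),
      ∀ z ∈ Set.Icc (T k j) (T k (j + 1)), |g y - g z| ≤ v k j := by
    have aux : ∀ {k j : ℕ}, j < 2 ^ k → ∀ y ∈ Set.Icc (T k j) (T k (j + 1)),
      ∀ z ∈ Set.Icc (T k j) (T k (j + 1)), y ≤ z → |g y - g z| ≤ v k j := by
      intro k j hj y hy z hz hyz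
      have h1 := hW y (hmem hj y hy) z (hmem hj z hz) hyz
      have h2 := (abs_nonneg _).trans
        (hW (T k j) (gridPt_mem hab hj.le) y (hmem hj y hy) hy.1)
      have h3 := (abs_nonneg _).trans
        (hW z (hmem hj z hz) (T k (j + 1)) (gridPt_mem hab hj) hz.2)
      simp only [hv]; linarith
    intro k j hj y hy z hz
    rcases le_total y z with h | h
    · exact aux hj y hy z hz h
    · rw [abs_sub_comm]; exact aux hj z hz y hy h
  have hvn : ∀ {k j : ℕ}, j < 2 ^ k → 0 ≤ v k j := fun {k j} hj =>
    (abs_nonneg _).trans (hosc hj (T k j) ⟨le_rfl, (hTlt k j).le⟩ (T k j) ⟨le_rfl, (hTlt k j).le⟩)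
  have hvs : ∀ k, ∑ j ∈ Finset.range (2 ^ k), v k j ≤ V := by
    intro k
    simp only [hv]
    rw [Finset.sum_range_sub (fun j => W (T k j)), hT, gridPt_last, gridPt_zero]
    exact hWV
  have hV : 0 ≤ V := (Finset.sum_nonneg fun j hj => hvn (Finset.mem_range.1 hj)).trans (hvs 0)
  have hF1 : ∀ {k j : ℕ}, j < 2 ^ k → ∀ y ∈ Set.Icc (T k j) (T k (j + 1)),
      |g y - c k j| ≤ v k j := by
    intro k j hj y hy
    rw [abs_sub_comm]
    exact abs_mean_sub_le (hTlt k j) (hint hg hj) fun z hz => hosc hj z ⟨hz.1.le, hz.2⟩ y hy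
  have e1 : ∀ k j, T (k + 1) (2 * j) = T k j := gridPt_succ_two_mul a b
  have e2 : ∀ k j, T (k + 1) (2 * j + 1 + 1) = T k (j + 1) := fun k j => by
    rw [show 2 * j + 1 + 1 = 2 * (j + 1) by ring, e1]
  have hc0 : ∀ k, ∀ j < 2 ^ k, |c (k + 1) (2 * j) - c k j| ≤ v k j := fun k j hj =>
    abs_mean_sub_le (hTlt _ _) (hint hg (by rw [pow_succ]; omega)) fun z hz => by
      rw [e1] at hz
      exact hF1 hj z ⟨hz.1.le, hz.2.trans ((hTlt (k + 1) (2 * j + 1)).le.trans (e2 k j).le)⟩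
  have hc1 : ∀ k, ∀ j < 2 ^ k, |c (k + 1) (2 * j + 1) - c k j| ≤ v k j := fun k j hj =>
    abs_mean_sub_le (hTlt _ _) (hint hg (by rw [pow_succ]; omega)) fun z hz => by
      rw [e2] at hz
      refine hF1 hj z ⟨?_, hz.2⟩
      rw [← e1]
      exact (hTlt _ _).le.trans hz.1.le
  have hsq : ∀ k, ∑ j ∈ Finset.range (2 ^ k), c k j ^ 2 ≤ 2 ^ k * s ^ 2 := by
    intro k
    have h1 : ∑ j ∈ Finset.range (2 ^ k), c k j ^ 2 * ((b - a) / 2 ^ k) ≤ (b - a) * s ^ 2 := by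
      refine le_trans ?_ ((hsum hg2 k).le.trans hs2)
      refine Finset.sum_le_sum fun j hj => ?_
      have hj := Finset.mem_range.1 hj
      have := mean_sq_mul_le (hTlt k j) (hint hg hj) (hint hg2 hj)
      rw [← gridPt_succ_sub a b k j]
      exact this
    rw [← Finset.sum_mul] at h1
    have h2 : (∑ j ∈ Finset.range (2 ^ k), c k j ^ 2) * (b - a) ≤ (2 ^ k * s ^ 2) * (b - a) := by
      have h3 := mul_le_mul_of_nonneg_right h1 (by positivity : (0 : ℝ) ≤ 2 ^ k)
      field_simp at h3 ⊢
      linarith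
    exact le_of_mul_le_mul_right h2 hba
  have hmain := abs_dyadic_sum_le (Z := Z) hs hV
    (fun k j hj => cellDev_eq_add hab hf₀ n x hj) hvs hc0 hc1 hsq K
  set k := 2 * K with hk
  set I : ℕ → ℝ → ℝ := fun j => (Set.Ioc (T k j) (T k (j + 1))).indicator 1 with hI
  set p : ℕ → ℝ := fun j => ∫ t in T k j..T k (j + 1), f₀ t with hp
  have hI0 : ∀ j y, 0 ≤ I j y := fun j y => Set.indicator_nonneg (by simp) y
  have hZe : ∀ j, Z k j = (1 / (n : ℝ)) * ∑ i ∈ Finset.range n, I j (x i) - p j := fun _ => rfl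
  have hpt : ∀ i < n, |g (x i) - ∑ j ∈ Finset.range (2 ^ k), c k j * I j (x i)|
      ≤ ∑ j ∈ Finset.range (2 ^ k), v k j * I j (x i) := by
    intro i hi
    have h1 : g (x i) = ∑ j ∈ Finset.range (2 ^ k), g (x i) * I j (x i) := by
      rw [← Finset.mul_sum, sum_indicator_grid hab (hx i hi) k, mul_one]
    rw [h1, ← Finset.sum_sub_distrib]
    refine (Finset.abs_sum_le_sum_abs _ _).trans (Finset.sum_le_sum fun j hj => ?_)
    rw [← sub_mul, abs_mul, abs_of_nonneg (hI0 _ _)]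
    by_cases hm : x i ∈ Set.Ioc (T k j) (T k (j + 1))
    · exact mul_le_mul_of_nonneg_right (hF1 (Finset.mem_range.1 hj) _ ⟨hm.1.le, hm.2⟩) (hI0 _ _)
    · simp [hI, Set.indicator_of_notMem hm]
  have hcell : ∀ j < 2 ^ k, |(∫ t in T k j..T k (j + 1), g t * f₀ t) - c k j * p j|
      ≤ v k j * p j := by
    intro j hj
    simp only [hp]
    rw [← intervalIntegral.integral_const_mul, ← intervalIntegral.integral_const_mul,
      ← intervalIntegral.integral_sub (hint hgf hj) ((hint hf₀ hj).const_mul _), ← Real.norm_eq_abs]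
    refine intervalIntegral.norm_integral_le_of_norm_le (hTlt k j).le
      (Filter.Eventually.of_forall fun t ht => ?_) ((hint hf₀ hj).const_mul _)
    have ht' : t ∈ Set.Icc (T k j) (T k (j + 1)) := ⟨ht.1.le, ht.2⟩
    rw [← sub_mul, Real.norm_eq_abs, abs_mul, abs_of_nonneg (h0 t (hmem hj t ht'))]
    exact mul_le_mul_of_nonneg_right (hF1 hj t ht') (h0 t (hmem hj t ht'))
  have hP : |(1 / (n : ℝ)) * ∑ i ∈ Finset.range n,
        (g (x i) - ∑ j ∈ Finset.range (2 ^ k), c k j * I j (x i))|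
      ≤ ∑ j ∈ Finset.range (2 ^ k), v k j * (Z k j + p j) := by
    rw [abs_mul, abs_of_nonneg (by positivity)]
    calc _ ≤ (1 / (n : ℝ)) * ∑ i ∈ Finset.range n, ∑ j ∈ Finset.range (2 ^ k),
          v k j * I j (x i) := by
          gcongr
          exact (Finset.abs_sum_le_sum_abs _ _).trans
            (Finset.sum_le_sum fun i hi => hpt i (Finset.mem_range.1 hi))
      _ = _ := by
          rw [Finset.sum_comm, Finset.mul_sum]
          refine Finset.sum_congr rfl fun j _ => ?_
          rw [hZe, ← Finset.mul_sum]; ring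
  have hQ : |∑ j ∈ Finset.range (2 ^ k), ((∫ t in T k j..T k (j + 1), g t * f₀ t) - c k j * p j)|
      ≤ ∑ j ∈ Finset.range (2 ^ k), v k j * p j :=
    (Finset.abs_sum_le_sum_abs _ _).trans
      (Finset.sum_le_sum fun j hj => hcell j (Finset.mem_range.1 hj))
  have hdec : (1 / (n : ℝ)) * ∑ i ∈ Finset.range n, g (x i) - ∫ t in a..b, g t * f₀ t
      = ∑ j ∈ Finset.range (2 ^ k), c k j * Z k j
        + (1 / (n : ℝ)) * ∑ i ∈ Finset.range n,
          (g (x i) - ∑ j ∈ Finset.range (2 ^ k), c k j * I j (x i))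
        - ∑ j ∈ Finset.range (2 ^ k), ((∫ t in T k j..T k (j + 1), g t * f₀ t) - c k j * p j) := by
    have h1 : ∑ j ∈ Finset.range (2 ^ k), c k j * Z k j
        = (1 / (n : ℝ)) * ∑ i ∈ Finset.range n, ∑ j ∈ Finset.range (2 ^ k), c k j * I j (x i)
          - ∑ j ∈ Finset.range (2 ^ k), c k j * p j := by
      rw [Finset.sum_comm, Finset.mul_sum, ← Finset.sum_sub_distrib]
      refine Finset.sum_congr rfl fun j _ => ?_
      rw [hZe, ← Finset.mul_sum]; ring
    rw [h1, Finset.sum_sub_distrib, Finset.sum_sub_distrib, hsum hgf]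
    ring
  have hk2 : (2 : ℝ) ^ k = N ^ 2 := by rw [hk, mul_comm, pow_mul]
  have hple : ∀ j < 2 ^ k, p j ≤ M * (b - a) / N ^ 2 := fun j hj => by
    rw [← hk2]; exact integral_cell_le hab hf₀ hM hj
  have hMn : 0 ≤ M * (b - a) / N ^ 2 := by
    refine (integral_cell_nonneg hab h0 (k := k) (j := 0) (by positivity)).trans ?_
    exact hple 0 (by positivity)
  set R := chainStat Z K with hR
  have hQR : √(∑ j ∈ Finset.range (2 ^ k), Z k j ^ 6) * (N ^ 2) ^ 2 ≤ √R / N ^ 2 := by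
    rw [le_div_iff₀ (by positivity)]
    refine Real.le_sqrt_of_sq_le ?_
    have hA : R = chainStat Z K := rfl
    rw [chainStat] at hA
    have hn1 : 0 ≤ N ^ 3 * ∑ j ∈ Finset.range (2 ^ K), Z K j ^ 2 :=
      mul_nonneg (by positivity) (Finset.sum_nonneg fun _ _ => by positivity)
    have hn2 : 0 ≤ ∑ l ∈ Finset.range K, (2 * (10 / 9 : ℝ) ^ 5) ^ l * (N ^ 11 *
        ∑ j ∈ Finset.range (2 ^ (K + l + 1)), Z (K + l + 1) j ^ 6) :=
      Finset.sum_nonneg fun l _ => mul_nonneg (by positivity)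
        (mul_nonneg (by positivity) (sum_pow_mul_pow_six_nonneg _ _))
    have h6 := sum_pow_mul_pow_six_nonneg (Z k) (2 ^ k)
    rw [mul_assoc, mul_pow, Real.sq_sqrt h6]
    calc _ = N ^ 12 * ∑ j ∈ Finset.range (2 ^ k), Z k j ^ 6 := by ring
      _ ≤ R := by rw [hA]; linarith
  have hvz : ∑ j ∈ Finset.range (2 ^ k), v k j * |Z k j| ≤ V / N ^ 2 * (1 + √R) := by
    have h1 := sum_abs_mul_abs_le (Finset.range (2 ^ k)) (v k) (Z k)
      (t := 1 / N ^ 2) (by positivity)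
    have h2 : ∑ j ∈ Finset.range (2 ^ k), |v k j| = ∑ j ∈ Finset.range (2 ^ k), v k j :=
      Finset.sum_congr rfl fun j hj => abs_of_nonneg (hvn (Finset.mem_range.1 hj))
    have h3 : ∑ j ∈ Finset.range (2 ^ k), |v k j| * |Z k j|
        = ∑ j ∈ Finset.range (2 ^ k), v k j * |Z k j| :=
      Finset.sum_congr rfl fun j hj => by rw [abs_of_nonneg (hvn (Finset.mem_range.1 hj))]
    have h4 : √(∑ j ∈ Finset.range (2 ^ k), v k j ^ 2) ≤ V := by
      rw [Real.sqrt_le_left hV]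
      refine (Finset.sum_sq_le_sq_sum_of_nonneg fun j hj => hvn (Finset.mem_range.1 hj)).trans ?_
      exact pow_le_pow_left₀
        (Finset.sum_nonneg fun j hj => hvn (Finset.mem_range.1 hj)) (hvs k) 2
    rw [h2, h3] at h1
    refine h1.trans ?_
    calc _ ≤ 1 / N ^ 2 * V + V * √(∑ j ∈ Finset.range (2 ^ k), Z k j ^ 6) / (1 / N ^ 2) ^ 2 := by
          gcongr; exact hvs k
      _ = 1 / N ^ 2 * V + V * (√(∑ j ∈ Finset.range (2 ^ k), Z k j ^ 6) * (N ^ 2) ^ 2) := by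
          field_simp
      _ ≤ 1 / N ^ 2 * V + V * (√R / N ^ 2) := by gcongr
      _ = _ := by ring
  have hres : ∑ j ∈ Finset.range (2 ^ k), v k j * (Z k j + p j)
      + ∑ j ∈ Finset.range (2 ^ k), v k j * p j
      ≤ V / N ^ 2 * (1 + √R) + V * (2 * (M * (b - a) / N ^ 2)) := by
    rw [← Finset.sum_add_distrib]
    calc _ ≤ ∑ j ∈ Finset.range (2 ^ k), (v k j * |Z k j| + v k j * (2 * (M * (b - a) / N ^ 2))) := by
          refine Finset.sum_le_sum fun j hj => ?_
          have hj := Finset.mem_range.1 hj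
          have h1 := mul_le_mul_of_nonneg_left (le_abs_self (Z k j)) (hvn hj)
          have h2 := mul_le_mul_of_nonneg_left (hple j hj) (hvn hj)
          linarith
      _ ≤ _ := by
          rw [Finset.sum_add_distrib, ← Finset.sum_mul]
          gcongr
          exact hvs k
  rw [hdec]
  have hVN : 0 ≤ V / N ^ 2 := by positivity
  have hsN : 0 ≤ s / N := by positivity
  have hMb : 0 ≤ M * (b - a) := by
    have := mul_nonneg hMn (sq_nonneg N)
    rwa [div_mul_cancel₀ _ (by positivity)] at this
  calc _ ≤ (s / N + V / N ^ 2) * (20 + 13 * √R)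
        + (V / N ^ 2 * (1 + √R) + V * (2 * (M * (b - a) / N ^ 2))) := by
        refine (abs_sub _ _).trans ?_
        refine le_trans (add_le_add_left (abs_add_le _ _) _) ?_
        linarith
    _ = (s / N + V / N ^ 2) * (20 + 13 * √R) + V / N ^ 2 * (1 + 2 * (M * (b - a)) + √R) := by ring
    _ ≤ (s / N + V / N ^ 2) * (20 + 13 * √R)
        + (s / N + V / N ^ 2) * (1 + 2 * (M * (b - a)) + √R) := by
        gcongr; linarith
    _ = _ := by ring

theorem mgf_le_exp_of_abs_le_one {Ω : Type*} [MeasurableSpace Ω] {μ : Measure Ω}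
    [IsProbabilityMeasure μ] {Y : Ω → ℝ} (hY : Measurable Y) (hb : ∀ ω, |Y ω| ≤ 1)
    (h0 : ∫ ω, Y ω ∂μ = 0) {q : ℝ} (hq : ∫ ω, Y ω ^ 2 ∂μ ≤ q) {s : ℝ} (hs : |s| ≤ 1) :
    ProbabilityTheory.mgf Y μ s ≤ Real.exp (s ^ 2 * q) := by
  have hi : Integrable Y μ := Integrable.of_bound hY.aestronglyMeasurable 1
    (Filter.Eventually.of_forall fun ω => hb ω)
  have hi2 : Integrable (fun ω => Y ω ^ 2) μ :=
    Integrable.of_bound (hY.pow_const 2).aestronglyMeasurable 1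
      (Filter.Eventually.of_forall fun ω => by
        rw [Real.norm_eq_abs, abs_pow]; exact pow_le_one₀ (abs_nonneg _) (hb ω))
  have hpt : ∀ ω, Real.exp (s * Y ω) ≤ 1 + s * Y ω + s ^ 2 * Y ω ^ 2 := by
    intro ω
    have h1 : |s * Y ω| ≤ 1 := by
      rw [abs_mul]; exact mul_le_one₀ hs (abs_nonneg _) (hb ω)
    have := (abs_le.1 (Real.abs_exp_sub_one_sub_id_le h1)).2
    rw [mul_pow] at this
    linarith
  calc ProbabilityTheory.mgf Y μ s ≤ ∫ ω, (1 + s * Y ω + s ^ 2 * Y ω ^ 2) ∂μ :=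
        integral_mono_of_nonneg (Filter.Eventually.of_forall fun ω => (Real.exp_pos _).le)
          (((integrable_const _).add (hi.const_mul s)).add (hi2.const_mul _))
          (Filter.Eventually.of_forall hpt)
    _ = 1 + s ^ 2 * ∫ ω, Y ω ^ 2 ∂μ := by
        have hA : Integrable (fun ω => 1 + s * Y ω) μ := (integrable_const _).add (hi.const_mul s)
        rw [integral_add hA (hi2.const_mul _),
          integral_add (integrable_const _) (hi.const_mul s), integral_const_mul,
          integral_const_mul, h0]
        simp
    _ ≤ s ^ 2 * q + 1 := by
        have := mul_le_mul_of_nonneg_left hq (sq_nonneg s)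
        linarith
    _ ≤ _ := Real.add_one_le_exp _

/-- Even moments of a sum of independent centred variables bounded by one. -/
theorem integral_sum_pow_le {Ω : Type*} [MeasurableSpace Ω] {μ : Measure Ω}
    [IsProbabilityMeasure μ] {Y : ℕ → Ω → ℝ} (hY : ∀ i, Measurable (Y i))
    (hind : ProbabilityTheory.iIndepFun Y μ) (hb : ∀ i ω, |Y i ω| ≤ 1)
    (h0 : ∀ i, ∫ ω, Y i ω ∂μ = 0) {q : ℝ} (hq : ∀ i, ∫ ω, Y i ω ^ 2 ∂μ ≤ q) {n : ℕ}
    (hn : 1 ≤ n * q) (m : ℕ) :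
    ∫ ω, (∑ i ∈ Finset.range n, Y i ω) ^ (2 * m) ∂μ ≤ 6 * (2 * m).factorial * (n * q) ^ m := by
  set r := (n : ℝ) * q with hr
  have hr0 : 0 < r := by linarith
  set s := 1 / √r with hs
  have hs0 : 0 < s := by positivity
  have hs1 : s ≤ 1 := by
    rw [hs, div_le_one (by positivity)]
    exact Real.one_le_sqrt.2 hn
  have hs2 : s ^ 2 = 1 / r := by rw [hs, div_pow, Real.sq_sqrt hr0.le, one_pow]
  set S : Ω → ℝ := ∑ i ∈ Finset.range n, Y i with hS
  have hSm : Measurable S := by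
    rw [hS, Finset.sum_fn]
    exact Finset.measurable_sum _ fun i _ => hY i
  have hSb : ∀ ω, |S ω| ≤ n := fun ω => by
    simp only [hS, Finset.sum_apply]
    refine (Finset.abs_sum_le_sum_abs _ _).trans ?_
    refine (Finset.sum_le_sum fun i _ => hb i ω).trans ?_
    simp
  have hmgf : ∀ t, |t| ≤ 1 → t ^ 2 = 1 / r → ProbabilityTheory.mgf S μ t ≤ Real.exp 1 := by
    intro t ht ht2
    rw [hS, hind.mgf_sum hY]
    calc _ ≤ ∏ i ∈ Finset.range n, Real.exp (t ^ 2 * q) :=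
          Finset.prod_le_prod (fun i _ => ProbabilityTheory.mgf_nonneg)
            fun i _ => mgf_le_exp_of_abs_le_one (hY i) (hb i) (h0 i) (hq i) ht
      _ = Real.exp 1 := by
          rw [Finset.prod_const, Finset.card_range, ← Real.exp_nat_mul, ht2]
          congr 1
          rw [← mul_assoc, mul_comm (n : ℝ), mul_assoc, ← hr]
          field_simp
  have hint : ∀ t : ℝ, Integrable (fun ω => Real.exp (t * S ω)) μ := fun t =>
    Integrable.of_bound (by fun_prop) (Real.exp (|t| * n))
      (Filter.Eventually.of_forall fun ω => by
        rw [Real.norm_eq_abs, Real.abs_exp, Real.exp_le_exp]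
        refine (le_abs_self _).trans ?_
        rw [abs_mul]
        exact mul_le_mul_of_nonneg_left (hSb ω) (abs_nonneg _))
  have hpt : ∀ ω, S ω ^ (2 * m) ≤
      ((2 * m).factorial * r ^ m) * (Real.exp (s * S ω) + Real.exp (-s * S ω)) := by
    intro ω
    have h1 := Real.pow_div_factorial_le_exp |s * S ω| (abs_nonneg _) (2 * m)
    rw [div_le_iff₀ (by positivity), pow_mul, sq_abs, ← pow_mul, mul_pow, pow_mul s, hs2, one_div,
      inv_pow, inv_mul_le_iff₀ (by positivity)] at h1
    have h2 : Real.exp |s * S ω| ≤ Real.exp (s * S ω) + Real.exp (-s * S ω) := by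
      rw [neg_mul]
      exact Real.exp_abs_le _
    calc _ ≤ _ := h1
      _ = ((2 * m).factorial * r ^ m) * Real.exp |s * S ω| := by ring
      _ ≤ _ := by gcongr
  have he : Real.exp 1 ≤ 3 := Real.exp_one_lt_d9.le.trans (by norm_num)
  have e : ∀ ω, ∑ i ∈ Finset.range n, Y i ω = S ω := fun ω => by simp [hS]
  simp only [e]
  calc _ ≤ ∫ ω, ((2 * m).factorial * r ^ m) * (Real.exp (s * S ω) + Real.exp (-s * S ω)) ∂μ :=
        integral_mono_of_nonneg
          (Filter.Eventually.of_forall fun ω => by simp only [pow_mul, Pi.zero_apply]; positivity)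
          (((hint s).add (hint (-s))).const_mul _) (Filter.Eventually.of_forall hpt)
    _ = ((2 * m).factorial * r ^ m) *
        (ProbabilityTheory.mgf S μ s + ProbabilityTheory.mgf S μ (-s)) := by
        rw [integral_const_mul, integral_add (hint s) (hint (-s))]; rfl
    _ ≤ ((2 * m).factorial * r ^ m) * (3 + 3) := by
        gcongr
        · exact (hmgf s (by rwa [abs_of_pos hs0]) hs2).trans he
        · exact (hmgf (-s) (by rwa [abs_neg, abs_of_pos hs0]) (by rw [neg_sq, hs2])).trans he
    _ = _ := by ring

theorem integral_indicator_Ioc_law {Ω : Type*} [MeasurableSpace Ω] {μ : Measure Ω}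
    {a b u w : ℝ} {f₀ : ℝ → ℝ} {Y : Ω → ℝ}
    (hY : Measurable Y) (hlaw : Measure.map Y μ =
      (volume.restrict (Set.Icc a b)).withDensity fun t => ENNReal.ofReal (f₀ t))
    (hf₀ : IntegrableOn f₀ (Set.Icc a b)) (h0 : ∀ t ∈ Set.Icc a b, 0 ≤ f₀ t)
    (huw : u ≤ w) (hu : a ≤ u) (hw : w ≤ b) :
    ∫ ω, (Set.Ioc u w).indicator (1 : ℝ → ℝ) (Y ω) ∂μ = ∫ t in u..w, f₀ t := by
  have hsub : Set.Ioc u w ⊆ Set.Icc a b := fun t ht => ⟨hu.trans ht.1.le, ht.2.trans hw⟩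
  have h1 : ∫ ω, (Set.Ioc u w).indicator (1 : ℝ → ℝ) (Y ω) ∂μ
      = (Measure.map Y μ).real (Set.Ioc u w) := by
    rw [← integral_indicator_one measurableSet_Ioc,
      integral_map hY.aemeasurable ((measurable_one.indicator measurableSet_Ioc).aestronglyMeasurable)]
  have h2 : Measure.map Y μ (Set.Ioc u w) = ENNReal.ofReal (∫ t in Set.Ioc u w, f₀ t) := by
    rw [hlaw, withDensity_apply _ measurableSet_Ioc, Measure.restrict_restrict measurableSet_Ioc,
      Set.inter_eq_left.2 hsub,
      ofReal_integral_eq_lintegral_ofReal (hf₀.mono_set hsub)]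
    exact (ae_restrict_iff' measurableSet_Ioc).2
      (Filter.Eventually.of_forall fun t ht => h0 t (hsub ht))
  rw [h1, intervalIntegral.integral_of_le huw, measureReal_def, h2, ENNReal.toReal_ofReal]
  exact setIntegral_nonneg measurableSet_Ioc fun t ht => h0 t (hsub ht)

theorem integral_cellDev_pow_le {Ω : Type*} [MeasurableSpace Ω] {μ : Measure Ω}
    [IsProbabilityMeasure μ] {a b M : ℝ} (hab : a < b) {f₀ : ℝ → ℝ} {X : ℕ → Ω → ℝ}
    (hX : ∀ i, Measurable (X i)) (hind : ProbabilityTheory.iIndepFun X μ)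
    (hlaw : ∀ i, Measure.map (X i) μ =
      (volume.restrict (Set.Icc a b)).withDensity fun t => ENNReal.ofReal (f₀ t))
    (hf₀ : IntegrableOn f₀ (Set.Icc a b)) (h0 : ∀ t ∈ Set.Icc a b, 0 ≤ f₀ t)
    (hM : ∀ t ∈ Set.Icc a b, f₀ t ≤ M) (hL : 1 ≤ M * (b - a)) {n k j : ℕ} (hn : 2 ^ k ≤ n)
    (hj : j < 2 ^ k) (m : ℕ) :
    ∫ ω, cellDev a b f₀ n (fun i => X i ω) k j ^ (2 * m) ∂μ
      ≤ 6 * (2 * m).factorial * (M * (b - a) / (2 ^ k * n)) ^ m := by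
  have hf₀' : IntervalIntegrable f₀ volume a b :=
    (intervalIntegrable_iff_integrableOn_Icc_of_le hab.le).2 hf₀
  have hn0 : (0 : ℝ) < n := by
    have : 0 < n := lt_of_lt_of_le (by positivity) hn
    exact_mod_cast this
  set u := gridPt a b k j with hu
  set w := gridPt a b k (j + 1) with hw
  set p := ∫ t in u..w, f₀ t with hp
  set ψ : ℝ → ℝ := fun x => (Set.Ioc u w).indicator 1 x - p with hψ
  have hψm : Measurable ψ := (measurable_one.indicator measurableSet_Ioc).sub_const _
  have huw : u ≤ w := gridPt_mono hab k j.le_succ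
  have hIm : ∀ i, Measurable fun ω => (Set.Ioc u w).indicator (1 : ℝ → ℝ) (X i ω) := fun i =>
    (measurable_one.indicator measurableSet_Ioc).comp (hX i)
  have hI01 : ∀ x, 0 ≤ (Set.Ioc u w).indicator (1 : ℝ → ℝ) x ∧
      (Set.Ioc u w).indicator (1 : ℝ → ℝ) x ≤ 1 ∧
      (Set.Ioc u w).indicator (1 : ℝ → ℝ) x ^ 2 = (Set.Ioc u w).indicator (1 : ℝ → ℝ) x := by
    intro x
    by_cases hx : x ∈ Set.Ioc u w <;> simp [hx]
  have hIi : ∀ i, Integrable (fun ω => (Set.Ioc u w).indicator (1 : ℝ → ℝ) (X i ω)) μ := fun i =>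
    Integrable.of_bound (hIm i).aestronglyMeasurable 1 (Filter.Eventually.of_forall fun ω => by
      rw [Real.norm_eq_abs, abs_of_nonneg (hI01 _).1]; exact (hI01 _).2.1)
  have hE : ∀ i, ∫ ω, (Set.Ioc u w).indicator (1 : ℝ → ℝ) (X i ω) ∂μ = p := fun i =>
    integral_indicator_Ioc_law (hX i) (hlaw i) hf₀ h0 huw (gridPt_mem hab hj.le).1
      (gridPt_mem hab hj).2
  have hp0 : 0 ≤ p := integral_cell_nonneg hab h0 hj
  have hp1 : p ≤ 1 := by
    rw [← hE 0]
    calc _ ≤ ∫ _, (1 : ℝ) ∂μ := integral_mono (hIi 0) (integrable_const _) fun ω => (hI01 _).2.1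
      _ = 1 := by simp
  have hpq : p ≤ M * (b - a) / 2 ^ k := integral_cell_le hab hf₀' hM hj
  have hYm : ∀ i, Measurable fun ω => ψ (X i ω) := fun i => hψm.comp (hX i)
  have hYi : ProbabilityTheory.iIndepFun (fun i ω => ψ (X i ω)) μ :=
    hind.comp (fun _ => ψ) fun _ => hψm
  have hYb : ∀ i ω, |ψ (X i ω)| ≤ 1 := fun i ω => by
    have := hI01 (X i ω)
    rw [abs_le]; constructor <;> simp only [hψ] <;> linarith
  have hY0 : ∀ i, ∫ ω, ψ (X i ω) ∂μ = 0 := fun i => by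
    simp only [hψ]
    rw [integral_sub (hIi i) (integrable_const _), hE]
    simp
  have hY2 : ∀ i, ∫ ω, ψ (X i ω) ^ 2 ∂μ ≤ M * (b - a) / 2 ^ k := fun i => by
    have e : ∀ ω, ψ (X i ω) ^ 2
        = (1 - 2 * p) * (Set.Ioc u w).indicator (1 : ℝ → ℝ) (X i ω) + p ^ 2 := fun ω => by
      have := (hI01 (X i ω)).2.2
      simp only [hψ]
      linear_combination this
    simp only [e]
    rw [integral_add ((hIi i).const_mul _) (integrable_const _), integral_const_mul, hE]
    simp only [integral_const, probReal_univ, smul_eq_mul, one_mul]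
    nlinarith
  have hnq : 1 ≤ n * (M * (b - a) / 2 ^ k) := by
    have h2 : ((2 : ℝ) ^ k) ≤ n := by exact_mod_cast hn
    rw [mul_div_assoc', le_div_iff₀ (by positivity)]
    nlinarith
  have key := integral_sum_pow_le hYm hYi hYb hY0 hY2 hnq m
  have e : ∀ ω, cellDev a b f₀ n (fun i => X i ω) k j ^ (2 * m)
      = (1 / (n : ℝ)) ^ (2 * m) * (∑ i ∈ Finset.range n, ψ (X i ω)) ^ (2 * m) := fun ω => by
    rw [← mul_pow]
    congr 1
    simp only [cellDev, hψ, Finset.sum_sub_distrib, Finset.sum_const, Finset.card_range,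
      nsmul_eq_mul]
    field_simp
    ring
  simp only [e]
  rw [integral_const_mul]
  refine (mul_le_mul_of_nonneg_left key (by positivity)).trans_eq ?_
  have : M * (b - a) / (2 ^ k * n) = (1 / (n : ℝ)) ^ 2 * (n * (M * (b - a) / 2 ^ k)) := by
    field_simp
  rw [this, mul_pow ((1 / (n : ℝ)) ^ 2), ← pow_mul, mul_pow]
  ring

theorem measurable_cellDev {Ω : Type*} [MeasurableSpace Ω] {X : ℕ → Ω → ℝ}
    (hX : ∀ i, Measurable (X i)) (a b : ℝ) (f₀ : ℝ → ℝ) (n k j : ℕ) :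
    Measurable fun ω => cellDev a b f₀ n (fun i => X i ω) k j :=
  ((Finset.measurable_sum _ fun i _ =>
    (measurable_one.indicator measurableSet_Ioc).comp (hX i)).const_mul _).sub_const _

theorem abs_cellDev_le (a b : ℝ) (f₀ : ℝ → ℝ) (n : ℕ) (x : ℕ → ℝ) (k j : ℕ) :
    |cellDev a b f₀ n x k j|
      ≤ 1 + |∫ t in gridPt a b k j..gridPt a b k (j + 1), f₀ t| := by
  refine (abs_sub _ _).trans ?_
  gcongr
  rw [abs_mul]
  have : |∑ i ∈ Finset.range n,
      (Set.Ioc (gridPt a b k j) (gridPt a b k (j + 1))).indicator (1 : ℝ → ℝ) (x i)| ≤ n := by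
    refine (Finset.abs_sum_le_sum_abs _ _).trans ?_
    refine (Finset.sum_le_sum (g := fun _ => (1 : ℝ)) fun i _ => ?_).trans (by simp)
    rw [Set.indicator_apply]
    split_ifs <;> simp
  rw [abs_of_nonneg (by positivity), one_div, inv_mul_eq_div]
  exact div_le_one_of_le₀ this (by positivity)

theorem integrable_cellDev_pow {Ω : Type*} [MeasurableSpace Ω] {μ : Measure Ω}
    [IsProbabilityMeasure μ] {X : ℕ → Ω → ℝ} (hX : ∀ i, Measurable (X i)) (a b : ℝ)
    (f₀ : ℝ → ℝ) (n k j m : ℕ) :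
    Integrable (fun ω => cellDev a b f₀ n (fun i => X i ω) k j ^ m) μ :=
  Integrable.of_bound ((measurable_cellDev hX a b f₀ n k j).pow_const m).aestronglyMeasurable
    ((1 + |∫ t in gridPt a b k j..gridPt a b k (j + 1), f₀ t|) ^ m)
    (Filter.Eventually.of_forall fun ω => by
      rw [Real.norm_eq_abs, abs_pow]
      exact pow_le_pow_left₀ (abs_nonneg _) (abs_cellDev_le a b f₀ n _ k j) m)

theorem integrable_chainStat {Ω : Type*} [MeasurableSpace Ω] {μ : Measure Ω}
    [IsProbabilityMeasure μ] {X : ℕ → Ω → ℝ} (hX : ∀ i, Measurable (X i)) (a b : ℝ)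
    (f₀ : ℝ → ℝ) (n K : ℕ) :
    Integrable (fun ω => chainStat (cellDev a b f₀ n fun i => X i ω) K) μ := by
  have h := integrable_cellDev_pow (μ := μ) hX a b f₀ n
  exact (((integrable_finsetSum _ fun j _ => h K j 2).const_mul _).add
    (integrable_finsetSum _ fun l _ =>
      ((integrable_finsetSum _ fun j _ => h (K + l + 1) j 6).const_mul _).const_mul _)).add
    ((integrable_finsetSum _ fun j _ => h (2 * K) j 6).const_mul _)

theorem integral_chainStat_le {Ω : Type*} [MeasurableSpace Ω] {μ : Measure Ω}
    [IsProbabilityMeasure μ] {a b M : ℝ} (hab : a < b) {f₀ : ℝ → ℝ} {X : ℕ → Ω → ℝ}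
    (hX : ∀ i, Measurable (X i)) (hind : ProbabilityTheory.iIndepFun X μ)
    (hlaw : ∀ i, Measure.map (X i) μ =
      (volume.restrict (Set.Icc a b)).withDensity fun t => ENNReal.ofReal (f₀ t))
    (hf₀ : IntegrableOn f₀ (Set.Icc a b)) (h0 : ∀ t ∈ Set.Icc a b, 0 ≤ f₀ t)
    (hM : ∀ t ∈ Set.Icc a b, f₀ t ≤ M) (hL : 1 ≤ M * (b - a)) {n K : ℕ} (hn : 8 ^ K ≤ n) :
    ∫ ω, chainStat (cellDev a b f₀ n fun i => X i ω) K ∂μ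
      ≤ 12 * (M * (b - a)) + 15120 * (M * (b - a)) ^ 3 := by
  have h := integrable_cellDev_pow (μ := μ) hX a b f₀ n
  set L := M * (b - a) with hLdef
  have hL0 : 0 < L := by linarith
  have hN : ((2 : ℝ) ^ K) ^ 3 ≤ n := by
    rw [← pow_mul, mul_comm, pow_mul]
    norm_num
    exact_mod_cast hn
  have hn2 : ∀ k ≤ 3 * K, 2 ^ k ≤ n := fun k hk =>
    (Nat.pow_le_pow_right (by norm_num) hk).trans (by rw [pow_mul]; exact hn)
  set N := (2 : ℝ) ^ K with hNdef
  have hN0 : 0 < N := by positivity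
  have hn0 : (0 : ℝ) < n := lt_of_lt_of_le (by positivity) hN
  have h2 : ∀ k ≤ 3 * K, ∀ j < 2 ^ k, ∫ ω, cellDev a b f₀ n (fun i => X i ω) k j ^ 2 ∂μ
      ≤ 12 * (L / (2 ^ k * N ^ 3)) := fun k hk j hj => by
    refine (integral_cellDev_pow_le hab hX hind hlaw hf₀ h0 hM hL (hn2 k hk) hj 1).trans ?_
    norm_num [Nat.factorial]
    gcongr
  have h6 : ∀ k ≤ 3 * K, ∀ j < 2 ^ k, ∫ ω, cellDev a b f₀ n (fun i => X i ω) k j ^ 6 ∂μ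
      ≤ 4320 * (L / (2 ^ k * N ^ 3)) ^ 3 := fun k hk j hj => by
    refine (integral_cellDev_pow_le hab hX hind hlaw hf₀ h0 hM hL (hn2 k hk) hj 3).trans ?_
    norm_num [Nat.factorial]
    gcongr
  have hs6 : ∀ k ≤ 3 * K, ∫ ω, ∑ j ∈ Finset.range (2 ^ k),
      cellDev a b f₀ n (fun i => X i ω) k j ^ 6 ∂μ ≤ 4320 * L ^ 3 / ((2 ^ k) ^ 2 * N ^ 9) := by
    intro k hk
    rw [integral_finsetSum _ fun j _ => h k j 6]
    refine (Finset.sum_le_sum fun j hj => h6 k hk j (Finset.mem_range.1 hj)).trans_eq ?_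
    simp only [Finset.sum_const, Finset.card_range, nsmul_eq_mul]
    push_cast
    field_simp
  have hs2 : ∫ ω, ∑ j ∈ Finset.range (2 ^ K),
      cellDev a b f₀ n (fun i => X i ω) K j ^ 2 ∂μ ≤ 12 * L / N ^ 3 := by
    rw [integral_finsetSum _ fun j _ => h K j 2]
    refine (Finset.sum_le_sum fun j hj => h2 K (by omega) j (Finset.mem_range.1 hj)).trans_eq ?_
    simp only [Finset.sum_const, Finset.card_range, nsmul_eq_mul]
    push_cast
    field_simp
  have i1 : Integrable (fun ω => N ^ 3 * ∑ j ∈ Finset.range (2 ^ K),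
      cellDev a b f₀ n (fun i => X i ω) K j ^ 2) μ :=
    (integrable_finsetSum _ fun j _ => h K j 2).const_mul _
  have i2 : ∀ l ∈ Finset.range K, Integrable (fun ω => (2 * (10 / 9) ^ 5 : ℝ) ^ l *
      (N ^ 11 * ∑ j ∈ Finset.range (2 ^ (K + l + 1)),
        cellDev a b f₀ n (fun i => X i ω) (K + l + 1) j ^ 6)) μ := fun l _ =>
    ((integrable_finsetSum _ fun j _ => h (K + l + 1) j 6).const_mul _).const_mul _
  have i3 : Integrable (fun ω => N ^ 12 * ∑ j ∈ Finset.range (2 ^ (2 * K)),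
      cellDev a b f₀ n (fun i => X i ω) (2 * K) j ^ 6) μ :=
    (integrable_finsetSum _ fun j _ => h (2 * K) j 6).const_mul _
  have i12 := i1.add (integrable_finsetSum _ i2)
  have e : ∫ ω, chainStat (cellDev a b f₀ n fun i => X i ω) K ∂μ
      = N ^ 3 * (∫ ω, ∑ j ∈ Finset.range (2 ^ K), cellDev a b f₀ n (fun i => X i ω) K j ^ 2 ∂μ)
        + (∑ l ∈ Finset.range K, (2 * (10 / 9) ^ 5 : ℝ) ^ l *
          (N ^ 11 * ∫ ω, ∑ j ∈ Finset.range (2 ^ (K + l + 1)),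
            cellDev a b f₀ n (fun i => X i ω) (K + l + 1) j ^ 6 ∂μ))
        + N ^ 12 * ∫ ω, ∑ j ∈ Finset.range (2 ^ (2 * K)),
          cellDev a b f₀ n (fun i => X i ω) (2 * K) j ^ 6 ∂μ := by
    rw [← integral_const_mul, ← integral_const_mul]
    simp only [← integral_const_mul]
    rw [← integral_finsetSum _ i2]
    exact (integral_add i12 i3).trans
      (congrArg (· + _) (integral_add i1 (integrable_finsetSum _ i2)))
  rw [e]
  have b1 : N ^ 3 * (∫ ω, ∑ j ∈ Finset.range (2 ^ K),
      cellDev a b f₀ n (fun i => X i ω) K j ^ 2 ∂μ) ≤ 12 * L := by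
    refine (mul_le_mul_of_nonneg_left hs2 (by positivity)).trans_eq ?_
    field_simp
  have b3 : N ^ 12 * (∫ ω, ∑ j ∈ Finset.range (2 ^ (2 * K)),
      cellDev a b f₀ n (fun i => X i ω) (2 * K) j ^ 6 ∂μ) ≤ 4320 * L ^ 3 := by
    refine (mul_le_mul_of_nonneg_left (hs6 (2 * K) (by omega)) (by positivity)).trans ?_
    rw [show (2 : ℝ) ^ (2 * K) = N ^ 2 by rw [mul_comm, pow_mul]]
    rw [show N ^ 12 * (4320 * L ^ 3 / ((N ^ 2) ^ 2 * N ^ 9)) = 4320 * L ^ 3 / N by field_simp]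
    exact div_le_self (by positivity) (one_le_pow₀ (by norm_num))
  have b2 : ∀ l ∈ Finset.range K, (2 * (10 / 9) ^ 5 : ℝ) ^ l *
      (N ^ 11 * ∫ ω, ∑ j ∈ Finset.range (2 ^ (K + l + 1)),
        cellDev a b f₀ n (fun i => X i ω) (K + l + 1) j ^ 6 ∂μ)
      ≤ 1080 * L ^ 3 * (9 / 10) ^ l := by
    intro l hl
    have hl' := Finset.mem_range.1 hl
    have := mul_le_mul_of_nonneg_left (hs6 (K + l + 1) (by omega))
      (show (0 : ℝ) ≤ N ^ 11 by positivity)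
    refine (mul_le_mul_of_nonneg_left this (by positivity)).trans ?_
    have e1 : (2 * (10 / 9) ^ 5 : ℝ) ^ l *
        (N ^ 11 * (4320 * L ^ 3 / ((2 ^ (K + l + 1)) ^ 2 * N ^ 9)))
        = 1080 * L ^ 3 * (2 * (10 / 9) ^ 5 / 4) ^ l := by
      generalize (2 * (10 / 9) ^ 5 : ℝ) = r
      rw [show (2 : ℝ) ^ (K + l + 1) = N * 2 ^ l * 2 by rw [pow_succ, pow_add], div_pow,
        show (4 : ℝ) ^ l = (2 ^ l) ^ 2 by rw [← pow_mul, mul_comm, pow_mul]; norm_num]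
      field_simp
      ring
    rw [e1]
    exact mul_le_mul_of_nonneg_left (pow_le_pow_left₀ (by norm_num) (by norm_num) l)
      (by positivity)
  have b2' := Finset.sum_le_sum b2
  rw [← Finset.mul_sum] at b2'
  have := mul_le_mul_of_nonneg_left (geom_sum_nine_tenths_le K)
    (show 0 ≤ 1080 * L ^ 3 by positivity)
  linarith

theorem abs_sub_le_variationOnFromTo {g : ℝ → ℝ} {s : Set ℝ} (hg : BoundedVariationOn g s)
    {c x y : ℝ} (hc : c ∈ s) (hx : x ∈ s) (hy : y ∈ s) (hxy : x ≤ y) :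
    |g x - g y| ≤ variationOnFromTo g s c y - variationOnFromTo g s c x := by
  have h := variationOnFromTo.add hg.locallyBoundedVariationOn hc hx hy
  have h2 : |g x - g y| ≤ variationOnFromTo g s x y := by
    rw [variationOnFromTo.eq_of_le _ _ hxy, ← Real.dist_eq]
    exact (hg.mono Set.inter_subset_left).dist_le ⟨hx, le_rfl, hxy⟩ ⟨hy, hxy, le_rfl⟩
  linarith

namespace InF

variable {a b : ℝ} {f f₀ : ℝ → ℝ}

theorem pos (h : InF a b f) {t : ℝ} (ht : t ∈ Set.Icc a b) : 0 < f t := h.1 t ht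

theorem integrableOn (h : InF a b f) : IntegrableOn f (Set.Icc a b) := h.2.1

theorem boundedVariationOn (h : InF a b f) :
    BoundedVariationOn (fun t => Real.log (f t)) (Set.Icc a b) := h.2.2.2

/-- A density in the class is bounded and bounded away from zero. -/
theorem exists_bounds (h : InF a b f) (hab : a < b) :
    ∃ m M : ℝ, 0 < m ∧ ∀ t ∈ Set.Icc a b, m ≤ f t ∧ f t ≤ M := by
  have ha : a ∈ Set.Icc a b := ⟨le_rfl, hab.le⟩
  refine ⟨Real.exp (Real.log (f a) - Ifun a b f), Real.exp (Real.log (f a) + Ifun a b f),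
    Real.exp_pos _, fun t ht => ?_⟩
  have h1 := h.boundedVariationOn.dist_le ht ha
  rw [Real.dist_eq, abs_le] at h1
  change -Ifun a b f ≤ _ ∧ _ ≤ Ifun a b f at h1
  rw [← Real.le_log_iff_exp_le (h.pos ht), ← Real.log_le_iff_le_exp (h.pos ht)]
  constructor <;> linarith

end InF

theorem Ifun_nonneg (a b : ℝ) (f : ℝ → ℝ) : 0 ≤ Ifun a b f := ENNReal.toReal_nonneg

theorem one_le_Jfun (a b : ℝ) (f₀ f : ℝ → ℝ) : 1 ≤ Jfun a b f₀ f := by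
  have := Ifun_nonneg a b f
  have := Ifun_nonneg a b f₀
  simp only [Jfun]
  linarith

theorem hellSq_nonneg (a b : ℝ) (f g : ℝ → ℝ) : 0 ≤ hellSq a b f g :=
  mul_nonneg (by norm_num) (integral_nonneg fun _ => sq_nonneg _)

theorem hell_nonneg (a b : ℝ) (f g : ℝ → ℝ) : 0 ≤ hell a b f g := Real.sqrt_nonneg _

theorem hell_sq (a b : ℝ) (f g : ℝ → ℝ) : hell a b f g ^ 2 = hellSq a b f g :=
  Real.sq_sqrt (hellSq_nonneg a b f g)

theorem log_exp_add_one_sub_le {u v : ℝ} (h : u ≤ v) :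
    |Real.log ((Real.exp u + 1) / 2) - Real.log ((Real.exp v + 1) / 2)| ≤ v - u := by
  have hu := Real.exp_pos u
  have hv := Real.exp_pos v
  have huv := Real.exp_le_exp.2 h
  have h1 : Real.log ((Real.exp u + 1) / 2) ≤ Real.log ((Real.exp v + 1) / 2) := by
    gcongr
  have h2 : Real.log ((Real.exp v + 1) / 2) ≤ Real.log (Real.exp (v - u) * ((Real.exp u + 1) / 2)) := by
    refine Real.log_le_log (by positivity) ?_
    have e : Real.exp (v - u) * Real.exp u = Real.exp v := by rw [← Real.exp_add]; ring_nf
    have : 1 ≤ Real.exp (v - u) := Real.one_le_exp (by linarith)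
    linarith
  rw [Real.log_mul (Real.exp_pos _).ne' (by positivity), Real.log_exp] at h2
  rw [abs_le]
  constructor <;> linarith

section Pointwise

variable {f f₀ : ℝ → ℝ} {t : ℝ}

theorem pfun_eq (hf : 0 < f t) (hf₀ : 0 < f₀ t) : pfun f₀ f t =
    (1 / 2) * Real.log ((Real.exp (Real.log (f t) - Real.log (f₀ t)) + 1) / 2) := by
  rw [Real.exp_sub, Real.exp_log hf, Real.exp_log hf₀, pfun]
  congr 2
  field_simp

theorem pfun_eq_sqrt (hf : 0 < f t) (hf₀ : 0 < f₀ t) :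
    pfun f₀ f t = Real.log √((f t + f₀ t) / (2 * f₀ t)) := by
  rw [Real.log_sqrt (by positivity), pfun]
  ring

theorem abs_pfun_sub_le {s : ℝ} (hf : 0 < f t) (hf₀ : 0 < f₀ t) (hs : 0 < f s) (hs₀ : 0 < f₀ s) :
    |pfun f₀ f t - pfun f₀ f s| ≤
      |Real.log (f t) - Real.log (f s)| + |Real.log (f₀ t) - Real.log (f₀ s)| := by
  rw [pfun_eq hf hf₀, pfun_eq hs hs₀, ← mul_sub, abs_mul]
  set u := Real.log (f t) - Real.log (f₀ t) with hu
  set v := Real.log (f s) - Real.log (f₀ s) with hv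
  have h1 : |Real.log ((Real.exp u + 1) / 2) - Real.log ((Real.exp v + 1) / 2)| ≤ |u - v| := by
    rcases le_total u v with h | h
    · rw [abs_sub_comm u v, abs_of_nonneg (sub_nonneg.2 h)]
      exact log_exp_add_one_sub_le h
    · rw [abs_sub_comm, abs_of_nonneg (sub_nonneg.2 h)]
      exact log_exp_add_one_sub_le h
  have h2 : |u - v| ≤ |Real.log (f t) - Real.log (f s)| + |Real.log (f₀ t) - Real.log (f₀ s)| := by
    have : u - v = (Real.log (f t) - Real.log (f s)) - (Real.log (f₀ t) - Real.log (f₀ s)) := by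
      rw [hu, hv]; ring
    rw [this]
    exact abs_sub _ _
  rw [abs_of_pos (by norm_num : (0 : ℝ) < 1 / 2)]
  linarith [abs_nonneg (u - v), h1, h2]

theorem pfun_sq_mul_le (hf : 0 < f t) (hf₀ : 0 < f₀ t) :
    pfun f₀ f t ^ 2 * f₀ t ≤ (√(f t) - √(f₀ t)) ^ 2 := by
  obtain ⟨x, hx, hx'⟩ : ∃ x, 0 < x ∧ x ^ 2 = f t := ⟨√(f t), by positivity, Real.sq_sqrt hf.le⟩
  obtain ⟨y, hy, hy'⟩ : ∃ y, 0 < y ∧ y ^ 2 = f₀ t := ⟨√(f₀ t), by positivity, Real.sq_sqrt hf₀.le⟩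
  have hz : (f t + f₀ t) / (2 * f₀ t) = ((x / y) ^ 2 + 1) / 2 := by
    rw [← hx', ← hy']; field_simp
  rw [pfun_eq_sqrt hf hf₀, hz, ← hx', ← hy', Real.sqrt_sq hx.le, Real.sqrt_sq hy.le]
  set r := x / y with hr
  have hxr : x = r * y := by rw [hr]; field_simp
  have hr0 : 0 < r := by positivity
  set q := √((r ^ 2 + 1) / 2) with hq
  have hq0 : 0 < q := by positivity
  have hq2 : q ^ 2 = (r ^ 2 + 1) / 2 := Real.sq_sqrt (by positivity)
  have key : |Real.log q| ≤ |r - 1| := by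
    rcases le_total 1 r with h | h
    · have h1 : 1 ≤ q := by nlinarith
      have h2 : q ≤ r := by nlinarith
      rw [abs_of_nonneg (Real.log_nonneg h1), abs_of_nonneg (by linarith)]
      linarith [Real.log_le_sub_one_of_pos hq0]
    · have h1 : q ≤ 1 := by nlinarith
      rw [abs_of_nonpos (Real.log_nonpos hq0.le h1), abs_of_nonpos (by linarith)]
      have h3 := Real.log_le_sub_one_of_pos (show 0 < (q ^ 2)⁻¹ by positivity)
      rw [Real.log_inv, Real.log_pow] at h3
      push_cast at h3
      have h4 : (q ^ 2)⁻¹ - 1 ≤ 2 * (1 - r) := by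
        rw [hq2, sub_le_iff_le_add, inv_le_iff_one_le_mul₀ (by positivity)]
        nlinarith [mul_nonneg (sub_nonneg.2 h) (sq_nonneg r), sq_nonneg (r - 1)]
      linarith
  have := sq_le_sq.2 key
  rw [hxr, show (r * y - y) ^ 2 = (r - 1) ^ 2 * y ^ 2 by ring]
  gcongr

theorem pfun_mul_le (hf : 0 < f t) (hf₀ : 0 < f₀ t) :
    pfun f₀ f t * f₀ t ≤ (f t - f₀ t) / 4 - (1 / 32) * (√(f t) - √(f₀ t)) ^ 2 := by
  obtain ⟨x, hx, hx'⟩ : ∃ x, 0 < x ∧ x ^ 2 = f t := ⟨√(f t), by positivity, Real.sq_sqrt hf.le⟩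
  obtain ⟨y, hy, hy'⟩ : ∃ y, 0 < y ∧ y ^ 2 = f₀ t := ⟨√(f₀ t), by positivity, Real.sq_sqrt hf₀.le⟩
  have hz : (f t + f₀ t) / (2 * f₀ t) = ((x / y) ^ 2 + 1) / 2 := by
    rw [← hx', ← hy']; field_simp
  rw [pfun_eq_sqrt hf hf₀, hz, ← hx', ← hy', Real.sqrt_sq hx.le, Real.sqrt_sq hy.le]
  set r := x / y with hr
  have hxr : x = r * y := by rw [hr]; field_simp
  have hr0 : 0 < r := by positivity
  set q := √((r ^ 2 + 1) / 2) with hq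
  have hq0 : 0 < q := by positivity
  have hq2 : q ^ 2 = (r ^ 2 + 1) / 2 := Real.sq_sqrt (by positivity)
  have h1 := Real.log_le_sub_one_of_pos hq0
  have h2 : q ≤ 1 + 2 * r := by nlinarith
  have h3 : (r - 1) ^ 2 ≤ 16 * (q - 1) ^ 2 := by
    have e : (q - 1) * (q + 1) = (r - 1) * (r + 1) / 2 := by linear_combination hq2
    have e2 : ((r - 1) * (r + 1)) ^ 2 = (2 * (q - 1) * (q + 1)) ^ 2 := by
      congr 1; linear_combination -2 * e
    have e3 : (q + 1) ^ 2 ≤ (2 * (r + 1)) ^ 2 := by gcongr; linarith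
    have e4 : (r - 1) ^ 2 * (r + 1) ^ 2 ≤ (16 * (q - 1) ^ 2) * (r + 1) ^ 2 := by
      calc _ = 4 * (q - 1) ^ 2 * (q + 1) ^ 2 := by linear_combination e2
        _ ≤ 4 * (q - 1) ^ 2 * (2 * (r + 1)) ^ 2 := by gcongr
        _ = _ := by ring
    exact le_of_mul_le_mul_right e4 (by positivity)
  have h4 : Real.log q ≤ (r ^ 2 - 1) / 4 - (1 / 32) * (r - 1) ^ 2 := by
    linarith
  rw [hxr]
  calc _ ≤ ((r ^ 2 - 1) / 4 - (1 / 32) * (r - 1) ^ 2) * y ^ 2 := by gcongr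
    _ = _ := by ring

theorem log_sub_log_le_pfun (hf : 0 < f t) (hf₀ : 0 < f₀ t) :
    (1 / 4) * (Real.log (f t) - Real.log (f₀ t)) ≤ pfun f₀ f t := by
  rw [pfun_eq hf hf₀]
  set u := Real.log (f t) - Real.log (f₀ t)
  have h : u / 2 ≤ Real.log ((Real.exp u + 1) / 2) := by
    rw [Real.le_log_iff_exp_le (by positivity)]
    have e : Real.exp u = Real.exp (u / 2) ^ 2 := by
      rw [← Real.exp_nat_mul]; congr 1; push_cast; ring
    rw [e]
    nlinarith [sq_nonneg (Real.exp (u / 2) - 1)]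
  linarith

end Pointwise

section Class

variable {a b : ℝ} {f f₀ : ℝ → ℝ}

theorem aestronglyMeasurable_pfun (hf : InF a b f) (hf₀ : InF a b f₀) :
    AEStronglyMeasurable (pfun f₀ f) (volume.restrict (Set.Icc a b)) := by
  have h1 := hf.integrableOn.aestronglyMeasurable.aemeasurable
  have h2 := hf₀.integrableOn.aestronglyMeasurable.aemeasurable
  exact ((Real.measurable_log.comp_aemeasurable
    ((h1.add h2).div (h2.const_mul 2))).const_mul (1 / 2)).aestronglyMeasurable

theorem exists_abs_pfun_le (hab : a < b) (hf : InF a b f) (hf₀ : InF a b f₀) :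
    ∃ B, ∀ t ∈ Set.Icc a b, |pfun f₀ f t| ≤ B := by
  have ha : a ∈ Set.Icc a b := ⟨le_rfl, hab.le⟩
  refine ⟨|pfun f₀ f a| + (Ifun a b f + Ifun a b f₀), fun t ht => ?_⟩
  have h1 := abs_pfun_sub_le (hf.pos ht) (hf₀.pos ht) (hf.pos ha) (hf₀.pos ha)
  have h2 := hf.boundedVariationOn.dist_le ht ha
  have h3 := hf₀.boundedVariationOn.dist_le ht ha
  rw [Real.dist_eq] at h2 h3
  have h4 := abs_sub_abs_le_abs_sub (pfun f₀ f t) (pfun f₀ f a)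
  simp only [Ifun]
  linarith

theorem ae_abs_pfun_pow_le {B : ℝ} (hB : ∀ t ∈ Set.Icc a b, |pfun f₀ f t| ≤ B) (k : ℕ) :
    ∀ᵐ t ∂volume.restrict (Set.Icc a b), ‖pfun f₀ f t ^ k‖ ≤ B ^ k :=
  (ae_restrict_iff' measurableSet_Icc).2 (Filter.Eventually.of_forall fun t ht => by
    rw [Real.norm_eq_abs, abs_pow]
    exact pow_le_pow_left₀ (abs_nonneg _) (hB t ht) k)

theorem integrableOn_pfun_pow (hab : a < b) (hf : InF a b f) (hf₀ : InF a b f₀) (k : ℕ) :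
    IntegrableOn (fun t => pfun f₀ f t ^ k) (Set.Icc a b) := by
  obtain ⟨B, hB⟩ := exists_abs_pfun_le hab hf hf₀
  exact Integrable.of_bound ((aestronglyMeasurable_pfun hf hf₀).pow k) (B ^ k)
    (ae_abs_pfun_pow_le hB k)

theorem integrableOn_pfun_pow_mul (hab : a < b) (hf : InF a b f) (hf₀ : InF a b f₀) (k : ℕ) :
    IntegrableOn (fun t => pfun f₀ f t ^ k * f₀ t) (Set.Icc a b) := by
  obtain ⟨B, hB⟩ := exists_abs_pfun_le hab hf hf₀
  exact Integrable.bdd_mul hf₀.integrableOn ((aestronglyMeasurable_pfun hf hf₀).pow k)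
    (ae_abs_pfun_pow_le hB k)

theorem integrableOn_sqrt_sub_sqrt_sq (hf : InF a b f) (hf₀ : InF a b f₀) :
    IntegrableOn (fun t => (√(f t) - √(f₀ t)) ^ 2) (Set.Icc a b) := by
  have h1 := hf.integrableOn.aestronglyMeasurable
  have h2 := hf₀.integrableOn.aestronglyMeasurable
  refine Integrable.mono' (hf.integrableOn.add hf₀.integrableOn)
    (((Real.continuous_sqrt.comp_aestronglyMeasurable h1).sub
      (Real.continuous_sqrt.comp_aestronglyMeasurable h2)).pow 2) ?_
  refine (ae_restrict_iff' measurableSet_Icc).2 (Filter.Eventually.of_forall fun t ht => ?_)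
  rw [Real.norm_eq_abs, abs_of_nonneg (sq_nonneg _)]
  have h3 := Real.sq_sqrt (hf.pos ht).le
  have h4 := Real.sq_sqrt (hf₀.pos ht).le
  have h5 := mul_nonneg (Real.sqrt_nonneg (f t)) (Real.sqrt_nonneg (f₀ t))
  simp only [Pi.add_apply]
  nlinarith

theorem setIntegral_pfun_sq_le (hab : a < b) (hf : InF a b f) (hf₀ : InF a b f₀) {m : ℝ}
    (hm : 0 < m) (hmf : ∀ t ∈ Set.Icc a b, m ≤ f₀ t) :
    ∫ t in Set.Icc a b, pfun f₀ f t ^ 2 ≤ 2 / m * hellSq a b f f₀ := by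
  have h : ∀ t ∈ Set.Icc a b, pfun f₀ f t ^ 2 ≤ m⁻¹ * (√(f t) - √(f₀ t)) ^ 2 := fun t ht => by
    rw [le_inv_mul_iff₀ hm, mul_comm]
    exact (mul_le_mul_of_nonneg_left (hmf t ht) (sq_nonneg _)).trans
      (pfun_sq_mul_le (hf.pos ht) (hf₀.pos ht))
  refine (setIntegral_mono_on (integrableOn_pfun_pow hab hf hf₀ 2)
    ((integrableOn_sqrt_sub_sqrt_sq hf hf₀).const_mul _) measurableSet_Icc h).trans_eq ?_
  rw [integral_const_mul, hellSq]
  ring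

theorem setIntegral_pfun_mul_le (hab : a < b) (hf : InF a b f) (hf₀ : InF a b f₀) :
    ∫ t in Set.Icc a b, pfun f₀ f t * f₀ t ≤ -(hellSq a b f f₀ / 16) := by
  have hi : IntegrableOn (fun t => pfun f₀ f t * f₀ t) (Set.Icc a b) := by
    simpa only [pow_one] using integrableOn_pfun_pow_mul hab hf hf₀ 1
  have h1 : IntegrableOn (fun t => (f t - f₀ t) / 4) (Set.Icc a b) :=
    (hf.integrableOn.sub hf₀.integrableOn).div_const 4
  have h2 := (integrableOn_sqrt_sub_sqrt_sq hf hf₀).const_mul (1 / 32)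
  refine (setIntegral_mono_on hi (h1.sub h2) measurableSet_Icc
    fun t ht => pfun_mul_le (hf.pos ht) (hf₀.pos ht)).trans_eq ?_
  simp only [Pi.sub_apply]
  rw [integral_sub h1 h2, integral_const_mul, integral_div,
    integral_sub hf.integrableOn hf₀.integrableOn, hf.2.2.1, hf₀.2.2.1, hellSq]
  ring

theorem abs_empProc_pfun_le {Ω : Type*} {X : ℕ → Ω → ℝ} {ω : Ω} {n : ℕ} (hab : a < b)
    (hf : InF a b f) (hf₀ : InF a b f₀) {m M : ℝ} (hm : 0 < m)
    (hmM : ∀ t ∈ Set.Icc a b, m ≤ f₀ t ∧ f₀ t ≤ M) (hX : ∀ i < n, X i ω ∈ Set.Ioc a b) (K : ℕ) :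
    |empProc a b f₀ n X (pfun f₀ f) ω| ≤
      (√(2 / (m * (b - a))) * hell a b f f₀ / 2 ^ K + Jfun a b f₀ f / (2 ^ K) ^ 2) *
        (21 + 2 * (M * (b - a)) + 14 * √(chainStat (cellDev a b f₀ n fun i => X i ω) K)) := by
  have hba : 0 < b - a := sub_pos.2 hab
  have ha : a ∈ Set.Icc a b := ⟨le_rfl, hab.le⟩
  have hb : b ∈ Set.Icc a b := ⟨hab.le, le_rfl⟩
  have key := abs_empirical_le (g := pfun f₀ f) (f₀ := f₀) (M := M) (V := Jfun a b f₀ f)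
    (s := √(2 / (m * (b - a))) * hell a b f f₀)
    (W := fun t => variationOnFromTo (fun t => Real.log (f t)) (Set.Icc a b) a t
      + variationOnFromTo (fun t => Real.log (f₀ t)) (Set.Icc a b) a t)
    (n := n) hab (fun i => X i ω) hX
    ((intervalIntegrable_iff_integrableOn_Icc_of_le hab.le).2 hf₀.integrableOn)
    (fun t ht => (hf₀.pos ht).le) (fun t ht => (hmM t ht).2)
    ((intervalIntegrable_iff_integrableOn_Icc_of_le hab.le).2 (by
      simpa only [pow_one] using integrableOn_pfun_pow hab hf hf₀ 1))
    ((intervalIntegrable_iff_integrableOn_Icc_of_le hab.le).2 (integrableOn_pfun_pow hab hf hf₀ 2))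
    ((intervalIntegrable_iff_integrableOn_Icc_of_le hab.le).2 (by
      simpa only [pow_one] using integrableOn_pfun_pow_mul hab hf hf₀ 1))
    (fun u hu w hw huw => by
      have h1 := abs_pfun_sub_le (hf.pos hu) (hf₀.pos hu) (hf.pos hw) (hf₀.pos hw)
      have h2 := abs_sub_le_variationOnFromTo hf.boundedVariationOn ha hu hw huw
      have h3 := abs_sub_le_variationOnFromTo hf₀.boundedVariationOn ha hu hw huw
      linarith)
    (by
      simp only [variationOnFromTo.self, variationOnFromTo.eq_of_le _ _ hab.le, Set.inter_self,
        Jfun, Ifun]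
      linarith)
    (mul_nonneg (Real.sqrt_nonneg _) (hell_nonneg _ _ _ _))
    (by
      rw [intervalIntegral.integral_of_le hab.le, ← integral_Icc_eq_integral_Ioc, mul_pow,
        Real.sq_sqrt (by positivity), hell_sq]
      refine (setIntegral_pfun_sq_le hab hf hf₀ hm fun t ht => (hmM t ht).1).trans_eq ?_
      field_simp)
    K
  rw [intervalIntegral.integral_of_le hab.le, ← integral_Icc_eq_integral_Ioc] at key
  exact key

/-- The basic inequality for a minimizer of the penalized likelihood. -/
theorem hellSq_le_of_penalized_le {Ω : Type*} {X : ℕ → Ω → ℝ} {ω : Ω} {n : ℕ} (hab : a < b)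
    (hf : InF a b f) (hf₀ : InF a b f₀) (hX : ∀ i < n, X i ω ∈ Set.Ioc a b) {l : ℝ}
    (h : -((1 / (n : ℝ)) * ∑ i ∈ Finset.range n, Real.log (f (X i ω))) + l * Ifun a b f
      ≤ -((1 / (n : ℝ)) * ∑ i ∈ Finset.range n, Real.log (f₀ (X i ω))) + l * Ifun a b f₀) :
    hellSq a b f f₀ / 16 ≤
      empProc a b f₀ n X (pfun f₀ f) ω + l / 4 * (Ifun a b f₀ - Ifun a b f) := by
  have h1 : (1 / (n : ℝ)) * ((1 / 4) * (∑ i ∈ Finset.range n, Real.log (f (X i ω))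
      - ∑ i ∈ Finset.range n, Real.log (f₀ (X i ω))))
      ≤ (1 / (n : ℝ)) * ∑ i ∈ Finset.range n, pfun f₀ f (X i ω) := by
    refine mul_le_mul_of_nonneg_left ?_ (by positivity)
    rw [← Finset.sum_sub_distrib, Finset.mul_sum]
    refine Finset.sum_le_sum fun i hi => ?_
    have := Set.Ioc_subset_Icc_self (hX i (Finset.mem_range.1 hi))
    exact log_sub_log_le_pfun (hf.pos this) (hf₀.pos this)
  have h2 := setIntegral_pfun_mul_le hab hf hf₀
  simp only [empProc]
  linarith

end Class

theorem ae_mem_Ioc_of_law {Ω : Type*} [MeasurableSpace Ω] {μ : Measure Ω} {a b : ℝ} {f₀ : ℝ → ℝ}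
    {X : ℕ → Ω → ℝ} (hX : ∀ i, Measurable (X i))
    (hlaw : ∀ i, Measure.map (X i) μ =
      (volume.restrict (Set.Icc a b)).withDensity fun t => ENNReal.ofReal (f₀ t)) :
    ∀ᵐ ω ∂μ, ∀ i, X i ω ∈ Set.Ioc a b := by
  refine ae_all_iff.2 fun i => ae_of_ae_map (p := (· ∈ Set.Ioc a b)) (hX i).aemeasurable ?_
  rw [hlaw i]
  refine (withDensity_absolutelyContinuous _ _).ae_le ?_
  rw [← restrict_Ioc_eq_restrict_Icc]
  exact ae_restrict_mem measurableSet_Ioc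

theorem exists_cubeRoot {n : ℕ} {N : ℝ} (hN : 1 ≤ N) (h1 : N ^ 3 ≤ n) (h2 : (n : ℝ) ≤ (2 * N) ^ 3) :
    ∃ t : ℝ, N ≤ t ∧ t ≤ 2 * N ∧ (n : ℝ) ^ (-(1 : ℝ) / 3) = t⁻¹ ∧
      (n : ℝ) ^ (-(2 : ℝ) / 3) = (t ^ 2)⁻¹ ∧ (n : ℝ) ^ ((2 : ℝ) / 3) = t ^ 2 := by
  have hn : (0 : ℝ) ≤ n := n.cast_nonneg
  have ht : ((n : ℝ) ^ ((1 : ℝ) / 3)) ^ 3 = n := by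
    rw [← Real.rpow_natCast, ← Real.rpow_mul hn]
    norm_num
  have ht0 : 0 ≤ (n : ℝ) ^ ((1 : ℝ) / 3) := Real.rpow_nonneg hn _
  have e : (n : ℝ) ^ ((2 : ℝ) / 3) = ((n : ℝ) ^ ((1 : ℝ) / 3)) ^ 2 := by
    rw [← Real.rpow_natCast, ← Real.rpow_mul hn]
    norm_num
  refine ⟨(n : ℝ) ^ ((1 : ℝ) / 3), ?_, ?_, ?_, ?_, e⟩
  · exact le_of_pow_le_pow_left₀ three_ne_zero ht0 (by rwa [ht])
  · exact le_of_pow_le_pow_left₀ three_ne_zero (by linarith) (by rwa [ht])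
  · rw [neg_div, Real.rpow_neg hn]
  · rw [neg_div, Real.rpow_neg hn, e]

section Penalty

variable {Ω : Type*} {a b : ℝ} {f₀ : ℝ → ℝ} {X : ℕ → Ω → ℝ} {ω : Ω} {n : ℕ} {N D : ℝ}

theorem penalty_ratio_le (hN : 1 ≤ N) (h1 : N ^ 3 ≤ n) (h2 : (n : ℝ) ≤ (2 * N) ^ 3) (hD : 1 ≤ D)
    (hE : ∀ f, InF a b f → |empProc a b f₀ n X (pfun f₀ f) ω| ≤
      D * (hell a b f f₀ / N + Jfun a b f₀ f / N ^ 2)) {r : ℝ}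
    (hr : ∃ f : ℝ → ℝ, InF a b f ∧
      hell a b f f₀ ≤ (n : ℝ) ^ (-(1 : ℝ)/3) * Jfun a b f₀ f ∧
      r = 4 * |empProc a b f₀ n X (pfun f₀ f) ω| / Jfun a b f₀ f) : r ≤ 8 * D / N ^ 2 := by
  obtain ⟨t, ht1, -, e1, -, -⟩ := exists_cubeRoot hN h1 h2
  obtain ⟨f, hf, hh, rfl⟩ := hr
  have hJ := one_le_Jfun a b f₀ f
  have hJ0 : 0 < Jfun a b f₀ f := by linarith
  have hN0 : 0 < N := by linarith
  rw [e1] at hh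
  have hh' : hell a b f f₀ / N ≤ Jfun a b f₀ f / N ^ 2 := by
    have : hell a b f f₀ ≤ N⁻¹ * Jfun a b f₀ f := hh.trans (by gcongr)
    calc _ ≤ N⁻¹ * Jfun a b f₀ f / N := by gcongr
      _ = _ := by field_simp
  rw [div_le_iff₀ hJ0]
  have h3 := (hE f hf).trans (mul_le_mul_of_nonneg_left (add_le_add_left hh' _) (by linarith))
  calc _ ≤ _ := mul_le_mul_of_nonneg_left h3 (by norm_num : (0 : ℝ) ≤ 4)
    _ = _ := by ring

theorem lamFDE_le (hN : 1 ≤ N) (h1 : N ^ 3 ≤ n) (h2 : (n : ℝ) ≤ (2 * N) ^ 3) (hD : 1 ≤ D)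
    (hE : ∀ f, InF a b f → |empProc a b f₀ n X (pfun f₀ f) ω| ≤
      D * (hell a b f f₀ / N + Jfun a b f₀ f / N ^ 2)) :
    lamFDE a b f₀ n X ω ≤ 8 * D / N ^ 2 := by
  obtain ⟨t, ht1, -, -, e2, -⟩ := exists_cubeRoot hN h1 h2
  have hN0 : 0 < N := by linarith
  refine max_le (Real.sSup_le (fun r hr => penalty_ratio_le hN h1 h2 hD hE hr) (by positivity)) ?_
  rw [e2]
  calc (t ^ 2)⁻¹ ≤ (N ^ 2)⁻¹ := by gcongr
    _ ≤ 8 * D / N ^ 2 := by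
      rw [inv_eq_one_div]
      gcongr
      linarith

theorem hellSq_le_of_minimizer (hab : a < b) (hf₀ : InF a b f₀) {f : ℝ → ℝ} (hf : InF a b f)
    (hX : ∀ i < n, X i ω ∈ Set.Ioc a b) (hN : 1 ≤ N) (h1 : N ^ 3 ≤ n)
    (h2 : (n : ℝ) ≤ (2 * N) ^ 3) (hD : 1 ≤ D)
    (hE : ∀ f, InF a b f → |empProc a b f₀ n X (pfun f₀ f) ω| ≤
      D * (hell a b f f₀ / N + Jfun a b f₀ f / N ^ 2))
    (hmin : -((1 / (n : ℝ)) * ∑ i ∈ Finset.range n, Real.log (f (X i ω)))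
        + lamFDE a b f₀ n X ω * Ifun a b f
      ≤ -((1 / (n : ℝ)) * ∑ i ∈ Finset.range n, Real.log (f₀ (X i ω)))
        + lamFDE a b f₀ n X ω * Ifun a b f₀) :
    hellSq a b f f₀ ≤ 32 * (72 + 2 * Ifun a b f₀) * D ^ 2 / N ^ 2 := by
  obtain ⟨t, ht1, ht2, e1, e2, -⟩ := exists_cubeRoot hN h1 h2
  have hN0 : 0 < N := by linarith
  have hJ := one_le_Jfun a b f₀ f
  have hJ0 : 0 < Jfun a b f₀ f := by linarith
  have hI := Ifun_nonneg a b f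
  have hI₀ := Ifun_nonneg a b f₀
  have hbasic := hellSq_le_of_penalized_le hab hf hf₀ hX hmin
  have hlam := lamFDE_le hN h1 h2 hD hE
  have hlam0 : 0 ≤ lamFDE a b f₀ n X ω := le_max_of_le_right (by positivity)
  set l := lamFDE a b f₀ n X ω with hl
  set e := empProc a b f₀ n X (pfun f₀ f) ω with he
  set I₀ := Ifun a b f₀ with hI₀'
  have hDD : D ≤ D ^ 2 := by nlinarith
  have hu : 0 ≤ 1 / N ^ 2 := by positivity
  have hD2 : D / N ^ 2 ≤ D ^ 2 / N ^ 2 := by gcongr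
  have hlam' : l ≤ 8 * (D ^ 2 / N ^ 2) := by
    calc l ≤ 8 * (D / N ^ 2) := by rw [← mul_div_assoc]; exact hlam
      _ ≤ _ := by gcongr
  have hy : 0 ≤ D ^ 2 / N ^ 2 := by positivity
  rw [mul_div_assoc]
  set y := D ^ 2 / N ^ 2 with hy'
  by_cases hcase : hell a b f f₀ ≤ (n : ℝ) ^ (-(1 : ℝ)/3) * Jfun a b f₀ f
  · have hle : 4 * |e| / Jfun a b f₀ f ≤ l :=
      (le_csSup ⟨_, fun r hr => penalty_ratio_le hN h1 h2 hD hE hr⟩ ⟨f, hf, hcase, rfl⟩).trans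
        (le_max_left _ _)
    rw [div_le_iff₀ hJ0] at hle
    have h3 := le_abs_self e
    have h4 : l * Jfun a b f₀ f = l + l * Ifun a b f + l * I₀ := by simp only [Jfun]; ring
    nlinarith [mul_le_mul_of_nonneg_right hlam' hI₀]
  · rw [e1, not_le] at hcase
    have h3 : Jfun a b f₀ f / N ^ 2 ≤ 2 * (hell a b f f₀ / N) := by
      have : (2 * N)⁻¹ * Jfun a b f₀ f ≤ hell a b f f₀ :=
        le_trans (by gcongr; linarith) hcase.le
      rw [inv_mul_le_iff₀ (by positivity)] at this
      rw [div_le_iff₀ (by positivity)]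
      calc _ ≤ _ := this
        _ = _ := by field_simp
    have h4 : |e| ≤ D * (3 * (hell a b f f₀ / N)) :=
      (hE f hf).trans (mul_le_mul_of_nonneg_left (by linarith) (by linarith))
    have h5 : D * (3 * (hell a b f f₀ / N)) ≤ hell a b f f₀ ^ 2 / 32 + 72 * y := by
      have : y = (D / N) ^ 2 := by rw [hy', div_pow]
      rw [this]
      have e6 : D * (3 * (hell a b f f₀ / N)) = 3 * (D / N) * hell a b f f₀ := by ring
      rw [e6]
      nlinarith [sq_nonneg (hell a b f f₀ - 48 * (D / N))]
    rw [hell_sq] at h5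
    have h6 := le_abs_self e
    nlinarith [mul_le_mul_of_nonneg_right hlam' hI₀, mul_nonneg hlam0 hI]

end Penalty

theorem exists_abs_empProc_pfun_le {a b : ℝ} {f₀ : ℝ → ℝ} (hab : a < b) (hf₀ : InF a b f₀)
    {Ω : Type*} (X : ℕ → Ω → ℝ) :
    ∃ C : ℝ, 1 ≤ C ∧ ∀ (n K : ℕ) (ω : Ω), (∀ i < n, X i ω ∈ Set.Ioc a b) → ∀ f, InF a b f →
      |empProc a b f₀ n X (pfun f₀ f) ω| ≤
        C * (1 + √(chainStat (cellDev a b f₀ n fun i => X i ω) K)) *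
          (hell a b f f₀ / 2 ^ K + Jfun a b f₀ f / (2 ^ K) ^ 2) := by
  obtain ⟨m, M, hm, hmM⟩ := hf₀.exists_bounds hab
  have hM : 0 ≤ M * (b - a) := by
    have h := hmM a ⟨le_rfl, hab.le⟩
    exact mul_nonneg (by linarith) (by linarith)
  have hA := Real.sqrt_nonneg (2 / (m * (b - a)))
  refine ⟨(√(2 / (m * (b - a))) + 1) * (21 + 2 * (M * (b - a))), by nlinarith,
    fun n K ω hX f hf => (abs_empProc_pfun_le hab hf hf₀ hm hmM hX K).trans ?_⟩
  have hJ := one_le_Jfun a b f₀ f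
  have hh := hell_nonneg a b f f₀
  set A := √(2 / (m * (b - a)))
  set q := √(chainStat (cellDev a b f₀ n fun i => X i ω) K)
  have hq : 0 ≤ q := Real.sqrt_nonneg _
  set L := M * (b - a)
  have h1 : A * hell a b f f₀ / 2 ^ K + Jfun a b f₀ f / (2 ^ K) ^ 2 ≤
      (A + 1) * (hell a b f f₀ / 2 ^ K + Jfun a b f₀ f / (2 ^ K) ^ 2) := by
    have e1 : 0 ≤ hell a b f f₀ / 2 ^ K := by positivity
    have e2 : 0 ≤ A * (Jfun a b f₀ f / (2 ^ K) ^ 2) := mul_nonneg hA (by positivity)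
    rw [mul_div_assoc]
    linarith
  have h2 : 21 + 2 * L + 14 * q ≤ (21 + 2 * L) * (1 + q) := by
    nlinarith [mul_nonneg hM hq]
  have hpos : 0 ≤ (A + 1) * (hell a b f f₀ / 2 ^ K + Jfun a b f₀ f / (2 ^ K) ^ 2) := by positivity
  calc _ ≤ (A + 1) * (hell a b f f₀ / 2 ^ K + Jfun a b f₀ f / (2 ^ K) ^ 2) *
        ((21 + 2 * L) * (1 + q)) := by gcongr
    _ = _ := by ring

theorem exists_integral_chainStat_le {Ω : Type*} [MeasurableSpace Ω] {μ : Measure Ω}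
    [IsProbabilityMeasure μ] {a b : ℝ} (hab : a < b) {f₀ : ℝ → ℝ} (hf₀ : InF a b f₀)
    {X : ℕ → Ω → ℝ} (hX : ∀ i, Measurable (X i)) (hind : ProbabilityTheory.iIndepFun X μ)
    (hlaw : ∀ i, Measure.map (X i) μ =
      (volume.restrict (Set.Icc a b)).withDensity fun t => ENNReal.ofReal (f₀ t)) :
    ∃ B : ℝ, 0 ≤ B ∧ ∀ n K : ℕ, 8 ^ K ≤ n →
      ∫ ω, chainStat (cellDev a b f₀ n fun i => X i ω) K ∂μ ≤ B := by
  obtain ⟨m, M, -, hmM⟩ := hf₀.exists_bounds hab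
  have hba : 0 < b - a := sub_pos.2 hab
  have hL : 1 ≤ max M (1 / (b - a)) * (b - a) := by
    rw [← div_le_iff₀ hba]
    exact le_max_right _ _
  exact ⟨12 * (max M (1 / (b - a)) * (b - a)) + 15120 * (max M (1 / (b - a)) * (b - a)) ^ 3,
    by positivity, fun n K hn => integral_chainStat_le hab hX hind hlaw hf₀.integrableOn
      (fun t ht => (hf₀.pos ht).le) (fun t ht => (hmM t ht).2.trans (le_max_left _ _)) hL hn⟩

theorem pow_log_eight_bounds {n : ℕ} (hn : 1 ≤ n) :
    ((2 : ℝ) ^ Nat.log 8 n) ^ 3 ≤ n ∧ (n : ℝ) ≤ (2 * 2 ^ Nat.log 8 n) ^ 3 := by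
  have h1 := Nat.pow_log_le_self 8 (by omega : n ≠ 0)
  have h2 := (Nat.lt_pow_succ_log_self (by norm_num : 1 < 8) n).le
  have e : ((2 : ℝ) ^ Nat.log 8 n) ^ 3 = 8 ^ Nat.log 8 n := by
    rw [← pow_mul, mul_comm, pow_mul]; norm_num
  rw [mul_pow, e]
  constructor
  · exact_mod_cast h1
  · rw [pow_succ] at h2
    have : (n : ℝ) ≤ 8 ^ Nat.log 8 n * 8 := by exact_mod_cast h2
    linarith

/-- with the data-dependent penalty `λₙ`,
(i) `λₙ = O_P(n^{-2/3})`, and (ii) any fused density estimator, i.e. any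
`f̂ₙ ∈ F` minimizing `-Pₙ(log f) + λₙ·TV(log f)` over `F`, has squared
Hellinger risk `E[h²(f̂ₙ,f₀)] ≤ C n^{-2/3}` for `n` large. -/
theorem stmt_11
    {Ω : Type*} [MeasurableSpace Ω] (ℙ : Measure Ω) [IsProbabilityMeasure ℙ]
    (a b : ℝ) (hab : a < b)
    (f₀ : ℝ → ℝ) (hf₀ : InF a b f₀)
    (X : ℕ → Ω → ℝ) (hXmeas : ∀ i, Measurable (X i))
    (hXlaw : ∀ i, Measure.map (X i) ℙ =
      (MeasureTheory.volume.restrict (Set.Icc a b)).withDensity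
        (fun t => ENNReal.ofReal (f₀ t)))
    (hXindep : ProbabilityTheory.iIndepFun X ℙ) :
    (∀ ε > (0 : ℝ), ∃ K : ℝ, ∃ n₁ : ℕ, ∀ n ≥ n₁,
      ℙ.toOuterMeasure
          {ω | lamFDE a b f₀ n X ω * (n : ℝ) ^ ((2 : ℝ)/3) > K}
        < ENNReal.ofReal ε) ∧
    (∃ C : ℝ, ∃ n₀ : ℕ, ∀ n ≥ n₀, ∀ fhat : Ω → ℝ → ℝ,
      (∀ ω, InF a b (fhat ω)) →
      (∀ ω, ∀ f : ℝ → ℝ, InF a b f →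
        -((1 / (n : ℝ)) * ∑ i ∈ Finset.range n, Real.log (fhat ω (X i ω)))
            + lamFDE a b f₀ n X ω * Ifun a b (fhat ω)
          ≤ -((1 / (n : ℝ)) * ∑ i ∈ Finset.range n, Real.log (f (X i ω)))
            + lamFDE a b f₀ n X ω * Ifun a b f) →
      (∫⁻ ω, ENNReal.ofReal (hellSq a b (fhat ω) f₀) ∂ℙ)
        ≤ ENNReal.ofReal (C * (n : ℝ) ^ (-(2 : ℝ)/3))) := by
  obtain ⟨C, hC, hE⟩ := exists_abs_empProc_pfun_le hab hf₀ X
  obtain ⟨B, hB, hR⟩ := exists_integral_chainStat_le hab hf₀ hXmeas hXindep hXlaw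
  have hsupp := ae_mem_Ioc_of_law hXmeas hXlaw
  set R : ℕ → Ω → ℝ := fun n ω => chainStat (cellDev a b f₀ n fun i => X i ω) (Nat.log 8 n)
  have hR0 : ∀ n ω, 0 ≤ R n ω := fun n ω => chainStat_nonneg _ _
  have hRi : ∀ n, Integrable (R n) ℙ := fun n => integrable_chainStat hXmeas a b f₀ n _
  have hRB : ∀ n ≥ 1, ∫ ω, R n ω ∂ℙ ≤ B := fun n hn =>
    hR n _ (Nat.pow_log_le_self 8 (by omega))
  have hN1 : ∀ n : ℕ, (1 : ℝ) ≤ 2 ^ Nat.log 8 n := fun n => one_le_pow₀ (by norm_num)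
  have hD1 : ∀ n ω, 1 ≤ C * (1 + √(R n ω)) := fun n ω => by
    nlinarith [Real.sqrt_nonneg (R n ω)]
  constructor
  · intro ε hε
    set c := (B + 1) / ε with hc
    have hc0 : 0 < c := by positivity
    refine ⟨32 * (C * (1 + √c)), 1, fun n hn => ?_⟩
    obtain ⟨h1, h2⟩ := pow_log_eight_bounds hn
    obtain ⟨t, ht1, ht2, -, -, e⟩ := exists_cubeRoot (hN1 n) h1 h2
    have hsub : ({ω | lamFDE a b f₀ n X ω * (n : ℝ) ^ ((2 : ℝ)/3) > 32 * (C * (1 + √c))} : Set Ω)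
        ≤ᵐ[ℙ] {ω | c ≤ R n ω} := by
      filter_upwards [hsupp] with ω hω hlt
      change lamFDE a b f₀ n X ω * (n : ℝ) ^ ((2 : ℝ)/3) > 32 * (C * (1 + √c)) at hlt
      change c ≤ R n ω
      by_contra! hcon
      have hlam := lamFDE_le (hN1 n) h1 h2 (hD1 n ω) (hE n _ ω fun i _ => hω i)
      have hN := hN1 n
      set N := (2 : ℝ) ^ Nat.log 8 n
      have hD := hD1 n ω
      have ht0 : 0 ≤ t := by linarith
      have : lamFDE a b f₀ n X ω * (n : ℝ) ^ ((2 : ℝ)/3) ≤ 32 * (C * (1 + √c)) := by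
        rw [e]
        calc _ ≤ 8 * (C * (1 + √(R n ω))) / N ^ 2 * (2 * N) ^ 2 := by gcongr
          _ = 32 * (C * (1 + √(R n ω))) := by field_simp; ring
          _ ≤ _ := by gcongr
      linarith
    have hmarkov := mul_meas_ge_le_integral_of_nonneg
      (Filter.Eventually.of_forall (hR0 n)) (hRi n) c
    have hlt : ℙ.real {ω | c ≤ R n ω} < ε := by
      have h3 : c * ℙ.real {ω | c ≤ R n ω} ≤ B := hmarkov.trans (hRB n hn)
      have h4 : c * ε = B + 1 := by rw [hc]; field_simp
      by_contra! hcon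
      nlinarith
    calc _ ≤ ℙ {ω | c ≤ R n ω} := measure_mono_ae hsub
      _ = ENNReal.ofReal (ℙ.real {ω | c ≤ R n ω}) := (ofReal_measureReal).symm
      _ < _ := (ENNReal.ofReal_lt_ofReal_iff hε).2 hlt
  · set A := 32 * (72 + 2 * Ifun a b f₀) with hA
    have hA0 : 0 ≤ A := by have := Ifun_nonneg a b f₀; positivity
    refine ⟨8 * A * C ^ 2 * (1 + B), 1, fun n hn fhat hF hmin => ?_⟩
    obtain ⟨h1, h2⟩ := pow_log_eight_bounds hn
    obtain ⟨t, ht1, ht2, -, e, -⟩ := exists_cubeRoot (hN1 n) h1 h2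
    have hN := hN1 n
    set N := (2 : ℝ) ^ Nat.log 8 n with hNdef
    have hpt : ∀ᵐ ω ∂ℙ, ENNReal.ofReal (hellSq a b (fhat ω) f₀) ≤
        ENNReal.ofReal (2 * A * C ^ 2 / N ^ 2 * (1 + R n ω)) := by
      filter_upwards [hsupp] with ω hω
      refine ENNReal.ofReal_le_ofReal ?_
      refine (hellSq_le_of_minimizer hab hf₀ (hF ω) (fun i _ => hω i) hN h1 h2 (hD1 n ω)
        (hE n _ ω fun i _ => hω i) (hmin ω f₀ hf₀)).trans ?_
      have h3 := Real.sq_sqrt (hR0 n ω)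
      have h4 : (1 + √(R n ω)) ^ 2 ≤ 2 * (1 + R n ω) := by
        nlinarith [sq_nonneg (1 - √(R n ω))]
      calc _ = A * C ^ 2 / N ^ 2 * (1 + √(R n ω)) ^ 2 := by ring
        _ ≤ A * C ^ 2 / N ^ 2 * (2 * (1 + R n ω)) := by gcongr
        _ = _ := by ring
    have hi : Integrable (fun ω => 2 * A * C ^ 2 / N ^ 2 * (1 + R n ω)) ℙ :=
      ((integrable_const _).add (hRi n)).const_mul _
    refine (lintegral_mono_ae hpt).trans ?_
    rw [← ofReal_integral_eq_lintegral_ofReal hi (Filter.Eventually.of_forall fun ω =>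
      mul_nonneg (by positivity) (by linarith [hR0 n ω]))]
    refine ENNReal.ofReal_le_ofReal ?_
    rw [integral_const_mul, integral_add (integrable_const _) (hRi n), e]
    simp only [integral_const, probReal_univ, smul_eq_mul, one_mul]
    have h5 : 1 / N ^ 2 ≤ 4 * (t ^ 2)⁻¹ := by
      calc 1 / N ^ 2 = 4 * ((2 * N) ^ 2)⁻¹ := by field_simp; norm_num
        _ ≤ _ := by
          have : 0 < t := by linarith
          gcongr
    calc _ = 2 * A * C ^ 2 * (1 + ∫ ω, R n ω ∂ℙ) * (1 / N ^ 2) := by ring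
      _ ≤ 2 * A * C ^ 2 * (1 + B) * (4 * (t ^ 2)⁻¹) := by
        gcongr
        exact hRB n hn
      _ = _ := by ring
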